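/- arXiv:2304.00161 — 4 statements merged into one kernel-verified Lean document; each statement's English description precedes it below -/
import Mathlib

section
/- Let m ≥ 1 and d ≥ 1 be integers with md ≥ 2, let h be a Hermitian operator on ℂ^d with Tr h = 0, let |0_d⟩ be a fixed unit vector in ℂ^d, and let i < j be integers. Let U_i, U_{i+1}, …, U_{j−1} be independent Haar-random elements of U(md) acting on ℂ^m ⊗ ℂ^d. Define L := ⟨0_d| U_i† (1_m ⊗ h) U_i |0_d⟩ (an operator on ℂ^m), for each n the adjoint MPS channel M_n†(V) := ⟨0_d| U_n† (V ⊗ 1_d) U_n |0_d⟩ acting on operators V on ℂ^m, and Y := ( M_{j−1}† ∘ ⋯ ∘ M_{i+1}†(L) ) ⊗ 1_d, an operator on ℂ^m ⊗ ℂ^d. Then the expectation over all these Haar-random unitaries satisfies E[ Tr(Y²) − (Tr Y)²/(md) ] = m · Tr(h²) · η^{j−i}, where η := (1 − 1/m²)/(d − 1/(m²d)). -/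
open Matrix MeasureTheory
open scoped Kronecker

noncomputable instance (n : Type*) [Fintype n] [DecidableEq n] :
    MeasurableSpace (Matrix.unitaryGroup n ℂ) := borel _

instance (n : Type*) [Fintype n] [DecidableEq n] :
    BorelSpace (Matrix.unitaryGroup n ℂ) := ⟨rfl⟩

namespace MPSChain

variable (m d : ℕ)

/-- The isometric embedding `1_m ⊗ |0_d⟩ : ℂ^m → ℂ^m ⊗ ℂ^d` for a reference state `v = |0_d⟩`. -/
noncomputable def embed (v : Fin d → ℂ) : Matrix (Fin m × Fin d) (Fin m) ℂ :=
  fun p a => if p.1 = a then v p.2 else 0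

/-- The isometry `U (1_m ⊗ |0_d⟩)` associated with a unitary `U ∈ U(md)`. -/
noncomputable def iso (v : Fin d → ℂ) (U : Matrix.unitaryGroup (Fin m × Fin d) ℂ) :
    Matrix (Fin m × Fin d) (Fin m) ℂ :=
  (U : Matrix (Fin m × Fin d) (Fin m × Fin d) ℂ) * embed m d v

/-- `L = ⟨0_d| U† (1_m ⊗ h) U |0_d⟩`, an operator on the bond space `ℂ^m`. -/
noncomputable def Lop (v : Fin d → ℂ) (h : Matrix (Fin d) (Fin d) ℂ)
    (U : Matrix.unitaryGroup (Fin m × Fin d) ℂ) : Matrix (Fin m) (Fin m) ℂ :=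
  (iso m d v U)ᴴ * ((1 : Matrix (Fin m) (Fin m) ℂ) ⊗ₖ h) * iso m d v U

/-- The adjoint MPS channel `M†(V) = ⟨0_d| U† (V ⊗ 1_d) U |0_d⟩`. -/
noncomputable def Mdag (v : Fin d → ℂ) (U : Matrix.unitaryGroup (Fin m × Fin d) ℂ)
    (V : Matrix (Fin m) (Fin m) ℂ) : Matrix (Fin m) (Fin m) ℂ :=
  (iso m d v U)ᴴ * (V ⊗ₖ (1 : Matrix (Fin d) (Fin d) ℂ)) * iso m d v U

/-- `chain k W = M†_{W_{k-1}} ∘ ⋯ ∘ M†_{W_1} (L(W_0))`: the operator `L` built from the first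
unitary, propagated through the adjoint MPS channels of the remaining unitaries. -/
noncomputable def chain (v : Fin d → ℂ) (h : Matrix (Fin d) (Fin d) ℂ) :
    (k : ℕ) → (Fin k → Matrix.unitaryGroup (Fin m × Fin d) ℂ) → Matrix (Fin m) (Fin m) ℂ
  | 0, _ => 0
  | 1, W => Lop m d v h (W 0)
  | (k + 2), W => Mdag m d v (W (Fin.last (k + 1))) (chain v h (k + 1) (Fin.init W))

section InvariantForm

variable {n : Type*} [Fintype n] [DecidableEq n]

instance compactSpace_unitaryGroup : CompactSpace (Matrix.unitaryGroup n ℂ) := by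
  refine isCompact_iff_compactSpace.mp ?_
  have hK : IsCompact (Set.pi Set.univ fun _ : n => Set.pi Set.univ fun _ : n =>
      Metric.closedBall (0 : ℂ) 1) :=
    isCompact_univ_pi fun _ => isCompact_univ_pi fun _ => isCompact_closedBall _ _
  refine hK.of_isClosed_subset (isClosed_unitary (R := Matrix n n ℂ)) ?_
  intro U hU i _ j _
  simpa using entry_norm_bound_of_unitary hU i j

instance secondCountableTopology_unitaryGroup :
    SecondCountableTopology (Matrix.unitaryGroup n ℂ) :=
  have : SecondCountableTopology (Matrix n n ℂ) :=
    inferInstanceAs (SecondCountableTopology (n → n → ℂ))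
  TopologicalSpace.Subtype.secondCountableTopology _

lemma permMatrix_mem_unitaryGroup (σ : Equiv.Perm n) :
    σ.permMatrix ℂ ∈ Matrix.unitaryGroup n ℂ := by
  rw [Matrix.mem_unitaryGroup_iff, star_eq_conjTranspose, conjTranspose_permMatrix,
    ← permMatrix_mul]
  simp

lemma permMatrix_conj_single (σ : Equiv.Perm n) (i : n) :
    σ⁻¹.permMatrix ℂ * single i i (1 : ℂ) * (σ⁻¹.permMatrix ℂ)ᴴ = single (σ i) (σ i) 1 := by
  rw [conjTranspose_permMatrix, inv_inv, Equiv.Perm.permMatrix, Equiv.Perm.permMatrix,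
    PEquiv.toMatrix_toPEquiv_mul, PEquiv.mul_toMatrix_toPEquiv, submatrix_submatrix]
  ext a b
  simp [single_apply, Equiv.eq_symm_apply]

/-- A bilinear form on matrices that is invariant under unitary conjugation and annihilates the
identity is, on Hermitian matrices, a multiple of the covariance form. -/
lemma exists_eq_mul_of_conj_invariant [Nontrivial n]
    (B : Matrix n n ℂ →ₗ[ℂ] Matrix n n ℂ →ₗ[ℂ] ℂ)
    (hinv : ∀ W ∈ Matrix.unitaryGroup n ℂ, ∀ X Y, B (W * X * Wᴴ) (W * Y * Wᴴ) = B X Y)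
    (hone : ∀ X, B X 1 = 0) :
    ∃ c : ℂ, ∀ X : Matrix n n ℂ, X.IsHermitian →
      B X X = c * ((X * X).trace - X.trace ^ 2 / Fintype.card n) := by
  obtain ⟨i₀, j₀, hij₀⟩ := exists_pair_ne n
  have hN : (Fintype.card n : ℂ) ≠ 0 := Nat.cast_ne_zero.mpr Fintype.card_ne_zero
  let e : n → Matrix n n ℂ := fun i => single i i 1
  let β := B (e i₀) (e j₀)
  have hperm (σ : Equiv.Perm n) (i j : n) : B (e (σ i)) (e (σ j)) = B (e i) (e j) := by
    have := hinv _ (permMatrix_mem_unitaryGroup σ⁻¹) (e i) (e j)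
    rwa [permMatrix_conj_single, permMatrix_conj_single] at this
  have hoff {i j : n} (hij : i ≠ j) : B (e i) (e j) = β := by
    obtain ⟨σ, rfl, rfl⟩ := MulAction.is_two_pretransitive_iff.mp
      (Equiv.Perm.isMultiplyPretransitive n 2) hij₀ hij
    exact hperm σ i₀ j₀
  have hdiag (i : n) : B (e i) (e i) = β - Fintype.card n * β := by
    have h1 := hone (e i)
    rw [← Matrix.sum_single_one, map_sum, ← Finset.add_sum_erase _ _ (Finset.mem_univ i),
      Finset.sum_congr rfl fun j hj => hoff (Finset.ne_of_mem_erase hj).symm] at h1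
    rw [Finset.sum_const, Finset.card_erase_of_mem (Finset.mem_univ i), nsmul_eq_mul,
      Finset.card_univ, Nat.cast_pred Fintype.card_pos] at h1
    linear_combination h1
  have hall (i j : n) : B (e i) (e j) = β - if i = j then Fintype.card n * β else 0 := by
    split_ifs with h
    · rw [← h, hdiag]
    · rw [hoff h, sub_zero]
  refine ⟨-(Fintype.card n * β), fun X hX => ?_⟩
  let lam : n → ℂ := RCLike.ofReal ∘ hX.eigenvalues
  let W : Matrix n n ℂ := hX.eigenvectorUnitary
  have hW : Wᴴ * W = 1 := Matrix.mem_unitaryGroup_iff'.mp hX.eigenvectorUnitary.2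
  have hXW : X = W * diagonal lam * Wᴴ := by
    conv_lhs => rw [hX.spectral_theorem]
    rfl
  have hD : diagonal lam = ∑ i, lam i • e i := by
    ext a b
    simp [e, Matrix.sum_apply, diagonal_apply, single_apply, ite_and]
  have hBX : B X X = ∑ i, ∑ j, lam i * lam j * B (e i) (e j) := by
    rw [hXW, hinv _ hX.eigenvectorUnitary.2, hD]
    simp only [map_sum, map_smul, LinearMap.sum_apply, LinearMap.smul_apply, smul_eq_mul,
      Finset.mul_sum, mul_assoc]
    rw [Finset.sum_comm]
    exact Finset.sum_congr rfl fun _ _ => Finset.sum_congr rfl fun _ _ => mul_left_comm _ _ _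
  have hT1 : X.trace = ∑ i, lam i := by
    rw [hXW, Matrix.trace_mul_comm, ← Matrix.mul_assoc, hW, Matrix.one_mul, trace_diagonal]
  have hT2 : (X * X).trace = ∑ i, lam i * lam i := by
    have : X * X = W * (diagonal lam * diagonal lam) * Wᴴ := by
      rw [hXW]
      calc _ = W * diagonal lam * (Wᴴ * W) * diagonal lam * Wᴴ := by
            simp only [Matrix.mul_assoc]
        _ = _ := by rw [hW]; simp only [Matrix.mul_assoc, Matrix.one_mul]
    rw [this, Matrix.trace_mul_comm, ← Matrix.mul_assoc, hW, Matrix.one_mul, diagonal_mul_diagonal,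
      trace_diagonal]
  rw [hBX, hT1, hT2]
  simp only [hall, mul_sub, Finset.sum_sub_distrib, mul_ite, mul_zero, Finset.sum_ite_eq,
    Finset.mem_univ, if_true, ← Finset.sum_mul, ← Finset.mul_sum]
  field_simp
  ring

/-- The proportionality constant of an invariant form, read off by contracting it with the matrix
units. -/
lemma eq_mul_of_conj_invariant [Nontrivial n]
    (B : Matrix n n ℂ →ₗ[ℂ] Matrix n n ℂ →ₗ[ℂ] ℂ)
    (hinv : ∀ W ∈ Matrix.unitaryGroup n ℂ, ∀ X Y, B (W * X * Wᴴ) (W * Y * Wᴴ) = B X Y)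
    (hsymm : ∀ X Y, B X Y = B Y X) (hone : ∀ X, B X 1 = 0)
    {X : Matrix n n ℂ} (hX : X.IsHermitian) :
    B X X = (∑ a, ∑ b, B (single a b 1) (single b a 1)) / ((Fintype.card n : ℂ) ^ 2 - 1) *
      ((X * X).trace - X.trace ^ 2 / Fintype.card n) := by
  obtain ⟨c, hc⟩ := exists_eq_mul_of_conj_invariant B hinv hone
  have hN : (Fintype.card n : ℂ) ≠ 0 := Nat.cast_ne_zero.mpr Fintype.card_ne_zero
  have hN2 : (Fintype.card n : ℂ) ^ 2 - 1 ≠ 0 := by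
    have : 1 < Fintype.card n ^ 2 := one_lt_pow₀ Fintype.one_lt_card two_ne_zero
    rw [sub_ne_zero]
    exact_mod_cast this.ne'
  have hstar (Z : Matrix n n ℂ) :
      B Z Zᴴ = c * ((Z * Zᴴ).trace - Z.trace * Zᴴ.trace / Fintype.card n) := by
    obtain ⟨S, T, hS, hT, rfl⟩ : ∃ S T : Matrix n n ℂ, S.IsHermitian ∧ T.IsHermitian ∧
        Z = S + Complex.I • T :=
      ⟨realPart Z, imaginaryPart Z, (realPart Z).2, (imaginaryPart Z).2,
        (realPart_add_I_smul_imaginaryPart Z).symm⟩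
    have hadj : (S + Complex.I • T)ᴴ = S - Complex.I • T := by
      rw [conjTranspose_add, conjTranspose_smul, hS.eq, hT.eq]
      simp [sub_eq_add_neg]
    rw [hadj]
    simp only [map_add, map_sub, map_smul, LinearMap.add_apply, LinearMap.smul_apply, smul_eq_mul,
      Matrix.add_mul, Matrix.mul_sub, Matrix.smul_mul, Matrix.mul_smul, trace_add, trace_sub,
      trace_smul, hc S hS, hc T hT, hsymm T S, Matrix.trace_mul_comm T S]
    ring
  have hsum : ∑ a, ∑ b, B (single a b 1) (single b a 1) = c * ((Fintype.card n : ℂ) ^ 2 - 1) := by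
    have h (a b : n) : B (single a b 1) (single b a 1) =
        c * (1 - if a = b then 1 / (Fintype.card n : ℂ) else 0) := by
      have := hstar (single a b 1)
      rw [conjTranspose_single, star_one] at this
      rw [this]
      rcases eq_or_ne a b with rfl | hab
      · simp
      · simp [hab, trace_single_eq_of_ne]
    simp only [h, ← Finset.mul_sum, Finset.sum_sub_distrib, Finset.sum_ite_eq, Finset.mem_univ,
      if_true, Finset.sum_const, Finset.card_univ, nsmul_eq_mul]
    field_simp
  rw [hc X hX, hsum, mul_div_cancel_right₀ _ hN2]

end InvariantForm

section HaarAverage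

variable {n : Type*} [Fintype n]

/-- The bilinear form `(X, Y) ↦ Tr(RXRY) − Tr(RX) Tr(RY) / r`. -/
noncomputable def covForm (r : ℂ) (R X Y : Matrix n n ℂ) : ℂ :=
  (R * X * (R * Y)).trace - (R * X).trace * (R * Y).trace / r

lemma covForm_add_left (r : ℂ) (R X X' Y : Matrix n n ℂ) :
    covForm r R (X + X') Y = covForm r R X Y + covForm r R X' Y := by
  simp only [covForm, Matrix.mul_add, Matrix.add_mul, trace_add]
  ring

lemma covForm_smul_left (r c : ℂ) (R X Y : Matrix n n ℂ) :
    covForm r R (c • X) Y = c * covForm r R X Y := by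
  simp only [covForm, Matrix.mul_smul, Matrix.smul_mul, trace_smul, smul_eq_mul]
  ring

lemma covForm_comm (r : ℂ) (R X Y : Matrix n n ℂ) : covForm r R X Y = covForm r R Y X := by
  rw [covForm, covForm, Matrix.trace_mul_comm, mul_comm (R * X).trace]

lemma covForm_conj (r : ℂ) {W : Matrix n n ℂ} (R X Y : Matrix n n ℂ) :
    covForm r R (W * X * Wᴴ) (W * Y * Wᴴ) = covForm r (Wᴴ * R * W) X Y := by
  have h1 (Z : Matrix n n ℂ) : (R * (W * Z * Wᴴ)).trace = (Wᴴ * R * W * Z).trace := by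
    rw [← Matrix.mul_assoc, Matrix.trace_mul_comm]
    simp only [Matrix.mul_assoc]
  have h2 : (R * (W * X * Wᴴ) * (R * (W * Y * Wᴴ))).trace =
      (Wᴴ * R * W * X * (Wᴴ * R * W * Y)).trace := by
    rw [← Matrix.mul_assoc, ← Matrix.mul_assoc, Matrix.trace_mul_comm]
    simp only [Matrix.mul_assoc]
  rw [covForm, covForm, h1, h1, h2]

lemma covForm_conjTranspose_mul_mul {k : Type*} [Fintype k] (r : ℂ) (A : Matrix n k ℂ)
    (X : Matrix n n ℂ) :
    (Aᴴ * X * A * (Aᴴ * X * A)).trace - (Aᴴ * X * A).trace ^ 2 / r =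
      covForm r (A * Aᴴ) X X := by
  have h1 : (Aᴴ * X * A).trace = (A * Aᴴ * X).trace := by
    rw [Matrix.trace_mul_comm, ← Matrix.mul_assoc]
  have h2 : (Aᴴ * X * A * (Aᴴ * X * A)).trace = (A * Aᴴ * X * (A * Aᴴ * X)).trace := by
    rw [← Matrix.mul_assoc, Matrix.trace_mul_comm]
    simp only [Matrix.mul_assoc]
  rw [covForm, h1, h2, sq]

variable [DecidableEq n]

lemma covForm_one_right {r : ℂ} (hr : r ≠ 0) {R : Matrix n n ℂ} (hR : R * R = R)
    (hRr : R.trace = r) (X : Matrix n n ℂ) : covForm r R X 1 = 0 := by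
  rw [covForm, Matrix.mul_one, hRr, mul_div_cancel_right₀ _ hr, Matrix.trace_mul_comm,
    ← Matrix.mul_assoc, hR, sub_self]

lemma sum_covForm_single {r : ℂ} (hr : r ≠ 0) {R : Matrix n n ℂ} (hR : R * R = R)
    (hRr : R.trace = r) :
    ∑ a, ∑ b, covForm r R (single a b 1) (single b a 1) = r ^ 2 - 1 := by
  have h (a b : n) : covForm r R (single a b 1) (single b a 1) =
      R a a * R b b - R b a * R a b / r := by
    have h1 (a b : n) : (R * single a b 1).trace = R b a := by
      simp [Matrix.trace_mul_single]
    have h2 : (R * single a b 1 * (R * single b a 1)).trace = R a a * R b b := by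
      rw [← Matrix.mul_assoc, Matrix.trace_mul_single]
      simp [Matrix.mul_apply, single_apply, ite_and]
    rw [covForm, h1, h1, h2]
  have h1 : ∑ a, ∑ b, R a a * R b b = r * r := by
    rw [← Finset.sum_mul_sum, ← hRr]
    rfl
  have h2 : ∑ a, ∑ b, R b a * R a b = r := by
    rw [← hRr, ← congrArg trace hR, Finset.sum_comm]
    rfl
  simp only [h, Finset.sum_sub_distrib, ← Finset.sum_div, h1, h2]
  rw [div_self hr, sq]

variable (μ : Measure (Matrix.unitaryGroup n ℂ)) [IsProbabilityMeasure μ]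

lemma integrable_of_continuous {f : Matrix.unitaryGroup n ℂ → ℂ} (hf : Continuous f) :
    Integrable f μ :=
  hf.integrable_of_hasCompactSupport (HasCompactSupport.of_compactSpace f)

lemma integrable_covForm (r : ℂ) (P X Y : Matrix n n ℂ) :
    Integrable (fun U : Matrix.unitaryGroup n ℂ =>
      covForm r ((U : Matrix n n ℂ) * P * (U : Matrix n n ℂ)ᴴ) X Y) μ := by
  refine integrable_of_continuous μ ?_
  unfold covForm
  fun_prop

/-- The average of `covForm r (U P U†)` over the unitary group. -/
noncomputable def avgCovForm (r : ℂ) (P : Matrix n n ℂ) :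
    Matrix n n ℂ →ₗ[ℂ] Matrix n n ℂ →ₗ[ℂ] ℂ :=
  LinearMap.mk₂ ℂ
    (fun X Y => ∫ U : Matrix.unitaryGroup n ℂ,
      covForm r ((U : Matrix n n ℂ) * P * (U : Matrix n n ℂ)ᴴ) X Y ∂μ)
    (fun X X' Y => by
      simp only [covForm_add_left]
      exact integral_add (integrable_covForm μ r P X Y) (integrable_covForm μ r P X' Y))
    (fun c X Y => by
      simp only [covForm_smul_left, smul_eq_mul]
      exact integral_const_mul c _)
    (fun X Y Y' => by
      simp only [covForm_comm r _ X, covForm_add_left]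
      exact integral_add (integrable_covForm μ r P Y X) (integrable_covForm μ r P Y' X))
    (fun c X Y => by
      simp only [covForm_comm r _ X, covForm_smul_left, smul_eq_mul]
      exact integral_const_mul c _)

/-- The Haar average of the variance of a Hermitian matrix compressed to a random subspace. -/
lemma integral_covForm_self [Nontrivial n] [μ.IsMulLeftInvariant] {r : ℂ} (hr : r ≠ 0)
    {P : Matrix n n ℂ} (hP : P * P = P) (hPr : P.trace = r)
    {X : Matrix n n ℂ} (hX : X.IsHermitian) :
    ∫ U : Matrix.unitaryGroup n ℂ,
        covForm r ((U : Matrix n n ℂ) * P * (U : Matrix n n ℂ)ᴴ) X X ∂μ =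
      (r ^ 2 - 1) / ((Fintype.card n : ℂ) ^ 2 - 1) *
        ((X * X).trace - X.trace ^ 2 / Fintype.card n) := by
  have hU (U : Matrix.unitaryGroup n ℂ) : (U : Matrix n n ℂ)ᴴ * U = 1 :=
    Matrix.mem_unitaryGroup_iff'.mp U.2
  have hR (U : Matrix.unitaryGroup n ℂ) :
      (U : Matrix n n ℂ) * P * (U : Matrix n n ℂ)ᴴ * (U * P * (U : Matrix n n ℂ)ᴴ) =
        U * P * (U : Matrix n n ℂ)ᴴ := by
    calc _ = (U : Matrix n n ℂ) * P * ((U : Matrix n n ℂ)ᴴ * U) * P * (U : Matrix n n ℂ)ᴴ := by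
          simp only [Matrix.mul_assoc]
      _ = (U : Matrix n n ℂ) * (P * P) * (U : Matrix n n ℂ)ᴴ := by
          rw [hU, Matrix.mul_one]
          simp only [Matrix.mul_assoc]
      _ = _ := by rw [hP]
  have hRr (U : Matrix.unitaryGroup n ℂ) :
      ((U : Matrix n n ℂ) * P * (U : Matrix n n ℂ)ᴴ).trace = r := by
    rw [Matrix.trace_mul_comm, ← Matrix.mul_assoc, hU, Matrix.one_mul, hPr]
  have key := eq_mul_of_conj_invariant (avgCovForm μ r P) ?_ ?_ ?_ hX
  · have hsum : ∑ a, ∑ b, avgCovForm μ r P (single a b 1) (single b a 1) = r ^ 2 - 1 := by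
      simp only [avgCovForm, LinearMap.mk₂_apply]
      have hint (a b : n) := integrable_covForm μ r P (single a b 1) (single b a 1)
      rw [Finset.sum_congr rfl fun a _ => (integral_finsetSum _ fun b _ => hint a b).symm,
        ← integral_finsetSum _ fun a _ => integrable_finsetSum _ fun b _ => hint a b]
      simp [sum_covForm_single hr (hR _) (hRr _)]
    rw [hsum] at key
    exact key
  · intro W hW X Y
    simp only [avgCovForm, LinearMap.mk₂_apply, covForm_conj]
    have hWW : Wᴴ * W = 1 := Matrix.mem_unitaryGroup_iff'.mp hW
    refine (integral_mul_left_eq_self (fun U : Matrix.unitaryGroup n ℂ =>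
      covForm r (Wᴴ * ((U : Matrix n n ℂ) * P * (U : Matrix n n ℂ)ᴴ) * W) X Y)
      ⟨W, hW⟩).symm.trans (integral_congr_ae (ae_of_all _ fun U => ?_))
    refine congrArg (covForm r · X Y) ?_
    simp only [Submonoid.coe_mul, conjTranspose_mul]
    calc _ = (Wᴴ * W) * ((U : Matrix n n ℂ) * P * (U : Matrix n n ℂ)ᴴ) * (Wᴴ * W) := by
          simp only [Matrix.mul_assoc]
      _ = _ := by rw [hWW, Matrix.one_mul, Matrix.mul_one]
  · intro X Y
    simp only [avgCovForm, LinearMap.mk₂_apply, covForm_comm r _ X]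
  · intro X
    simp [avgCovForm, covForm_one_right hr (hR _) (hRr _)]

end HaarAverage

section Chain

variable {m d}

lemma embed_conjTranspose_mul_self {v : Fin d → ℂ} (hv : ∑ s, ‖v s‖ ^ 2 = 1) :
    (embed m d v)ᴴ * embed m d v = 1 := by
  have hv' : ∑ s, star (v s) * v s = 1 := by
    have h (s : Fin d) : star (v s) * v s = ((‖v s‖ ^ 2 : ℝ) : ℂ) := by
      simpa using Complex.conj_mul' (v s)
    simp only [h, ← Complex.ofReal_sum, hv, Complex.ofReal_one]
  ext a b
  rw [Matrix.mul_apply, Fintype.sum_prod_type]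
  rcases eq_or_ne a b with rfl | hab
  · rw [Finset.sum_eq_single a (by intro c _ hc; simp [embed, hc]) (by simp)]
    simpa [embed] using hv'
  · rw [Matrix.one_apply_ne hab]
    refine Finset.sum_eq_zero fun c _ => Finset.sum_eq_zero fun s _ => ?_
    rcases eq_or_ne c a with rfl | hc
    · simp [embed, hab]
    · simp [embed, hc]

lemma card_cast_prod : (Fintype.card (Fin m × Fin d) : ℂ) = m * d := by simp

/-- The Haar average of the variance of the compression of a Hermitian operator on `ℂ^m ⊗ ℂ^d` by
the isometry `U (1_m ⊗ |0_d⟩)`. -/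
lemma integral_variance_compression (hmd : 2 ≤ m * d)
    (μ : Measure (Matrix.unitaryGroup (Fin m × Fin d) ℂ))
    [μ.IsMulLeftInvariant] [IsProbabilityMeasure μ]
    {v : Fin d → ℂ} (hv : ∑ s, ‖v s‖ ^ 2 = 1)
    {X : Matrix (Fin m × Fin d) (Fin m × Fin d) ℂ} (hX : X.IsHermitian) :
    ∫ U, (((iso m d v U)ᴴ * X * iso m d v U * ((iso m d v U)ᴴ * X * iso m d v U)).trace -
        ((iso m d v U)ᴴ * X * iso m d v U).trace ^ 2 / (m : ℂ)) ∂μ =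
      ((m : ℂ) ^ 2 - 1) / (((m : ℂ) * d) ^ 2 - 1) *
        ((X * X).trace - X.trace ^ 2 / ((m : ℂ) * d)) := by
  have hm : (m : ℂ) ≠ 0 := by
    rintro h
    rw [Nat.cast_eq_zero.mp h] at hmd
    omega
  have : Nontrivial (Fin m × Fin d) := by
    rw [← Fintype.one_lt_card_iff_nontrivial, Fintype.card_prod, Fintype.card_fin, Fintype.card_fin]
    exact hmd
  have hE := embed_conjTranspose_mul_self (m := m) hv
  have hP : embed m d v * (embed m d v)ᴴ * (embed m d v * (embed m d v)ᴴ) =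
      embed m d v * (embed m d v)ᴴ := by
    rw [Matrix.mul_assoc, ← Matrix.mul_assoc _ (embed m d v), hE, Matrix.one_mul]
  have hPr : (embed m d v * (embed m d v)ᴴ).trace = m := by
    rw [Matrix.trace_mul_comm, hE, trace_one, Fintype.card_fin]
  have key := integral_covForm_self μ hm hP hPr hX
  rw [card_cast_prod] at key
  rw [← key]
  refine integral_congr_ae (ae_of_all _ fun U => ?_)
  refine (covForm_conjTranspose_mul_mul _ _ _).trans (congrArg (covForm (m : ℂ) · X X) ?_)
  simp only [iso, conjTranspose_mul, Matrix.mul_assoc]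

lemma isHermitian_chain (v : Fin d → ℂ) {h : Matrix (Fin d) (Fin d) ℂ} (hh : h.IsHermitian) :
    ∀ (k : ℕ) (W : Fin k → Matrix.unitaryGroup (Fin m × Fin d) ℂ),
      (chain m d v h k W).IsHermitian
  | 0, _ => isHermitian_zero
  | 1, W => by
    refine isHermitian_conjTranspose_mul_mul _ ?_
    rw [IsHermitian, conjTranspose_kronecker, conjTranspose_one, hh.eq]
  | k + 2, W => by
    refine isHermitian_conjTranspose_mul_mul _ ?_
    rw [IsHermitian, conjTranspose_kronecker, conjTranspose_one,
      (isHermitian_chain v hh (k + 1) (Fin.init W)).eq]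

lemma continuous_iso (v : Fin d → ℂ) : Continuous (iso m d v) := by
  unfold iso
  fun_prop

lemma continuous_kronecker_one :
    Continuous fun V : Matrix (Fin m) (Fin m) ℂ => V ⊗ₖ (1 : Matrix (Fin d) (Fin d) ℂ) := by
  refine continuous_matrix fun a b => ?_
  simp only [kroneckerMap_apply]
  fun_prop

lemma _root_.Continuous.Mdag {α : Type*} [TopologicalSpace α] (v : Fin d → ℂ)
    {U : α → Matrix.unitaryGroup (Fin m × Fin d) ℂ} {V : α → Matrix (Fin m) (Fin m) ℂ}
    (hU : Continuous U) (hV : Continuous V) : Continuous fun x => Mdag m d v (U x) (V x) := by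
  have hiso : Continuous fun x => iso m d v (U x) := (continuous_iso v).comp hU
  have hkron : Continuous fun x => V x ⊗ₖ (1 : Matrix (Fin d) (Fin d) ℂ) :=
    continuous_kronecker_one.comp hV
  unfold MPSChain.Mdag
  exact (hiso.matrix_conjTranspose.matrix_mul hkron).matrix_mul hiso

lemma continuous_chain (v : Fin d → ℂ) (h : Matrix (Fin d) (Fin d) ℂ) (k : ℕ) :
    Continuous (chain m d v h (k + 1)) := by
  induction k with
  | zero =>
    have hiso : Continuous fun W : Fin 1 → Matrix.unitaryGroup (Fin m × Fin d) ℂ =>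
        iso m d v (W 0) := (continuous_iso v).comp (continuous_apply 0)
    exact (hiso.matrix_conjTranspose.matrix_mul continuous_const).matrix_mul hiso
  | succ k ih =>
    have h_front : Continuous fun W : Fin (k + 2) → Matrix.unitaryGroup (Fin m × Fin d) ℂ =>
        (Fin.init W : Fin (k + 1) → Matrix.unitaryGroup (Fin m × Fin d) ℂ) :=
      continuous_pi fun j => continuous_apply j.castSucc
    have hc : Continuous fun W : Fin (k + 2) → Matrix.unitaryGroup (Fin m × Fin d) ℂ =>
        chain m d v h (k + 1) (Fin.init W) := ih.comp h_front
    exact Continuous.Mdag v (continuous_apply (Fin.last (k + 1))) hc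

lemma trace_kronecker_one_sq_sub (hd : (d : ℂ) ≠ 0) (K : Matrix (Fin m) (Fin m) ℂ) :
    ((K ⊗ₖ (1 : Matrix (Fin d) (Fin d) ℂ)) * (K ⊗ₖ (1 : Matrix (Fin d) (Fin d) ℂ))).trace -
        (K ⊗ₖ (1 : Matrix (Fin d) (Fin d) ℂ)).trace ^ 2 / ((m : ℂ) * d) =
      d * ((K * K).trace - K.trace ^ 2 / m) := by
  rw [← mul_kronecker_mul, trace_kronecker, trace_kronecker, Matrix.one_mul, trace_one,
    Fintype.card_fin]
  rcases eq_or_ne (m : ℂ) 0 with hm | hm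
  · simp [hm, mul_comm]
  · field_simp

/-- The average variance of the propagated operator. -/
lemma integral_variance_chain (hmd : 2 ≤ m * d)
    (μ : Measure (Matrix.unitaryGroup (Fin m × Fin d) ℂ))
    [μ.IsMulLeftInvariant] [IsProbabilityMeasure μ]
    {v : Fin d → ℂ} (hv : ∑ s, ‖v s‖ ^ 2 = 1)
    {h : Matrix (Fin d) (Fin d) ℂ} (hh : h.IsHermitian) (hh0 : h.trace = 0) (k : ℕ) :
    ∫ W, ((chain m d v h (k + 1) W * chain m d v h (k + 1) W).trace -
        (chain m d v h (k + 1) W).trace ^ 2 / (m : ℂ)) ∂(Measure.pi fun _ : Fin (k + 1) => μ) =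
      m * (h * h).trace * (((m : ℂ) ^ 2 - 1) / (((m : ℂ) * d) ^ 2 - 1)) ^ (k + 1) *
        (d : ℂ) ^ k := by
  have hd : (d : ℂ) ≠ 0 := by
    rintro h
    rw [Nat.cast_eq_zero.mp h] at hmd
    omega
  induction k with
  | zero =>
    have hX : ((1 : Matrix (Fin m) (Fin m) ℂ) ⊗ₖ h).IsHermitian := by
      rw [IsHermitian, conjTranspose_kronecker, conjTranspose_one, hh.eq]
    have key := integral_variance_compression hmd μ hv hX
    rw [← mul_kronecker_mul, trace_kronecker, trace_kronecker, hh0, Matrix.one_mul, trace_one,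
      Fintype.card_fin] at key
    refine ((measurePreserving_funUnique μ (Fin 1)).integral_comp' _).trans (key.trans ?_)
    ring
  | succ k ih =>
    let K := chain m d v h (k + 1)
    let f : Matrix.unitaryGroup (Fin m × Fin d) ℂ ×
        (Fin (k + 1) → Matrix.unitaryGroup (Fin m × Fin d) ℂ) → ℂ := fun p =>
      (Mdag m d v p.1 (K p.2) * Mdag m d v p.1 (K p.2)).trace -
        (Mdag m d v p.1 (K p.2)).trace ^ 2 / (m : ℂ)
    have hfc : Continuous f := by
      have hM : Continuous fun p : Matrix.unitaryGroup (Fin m × Fin d) ℂ ×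
          (Fin (k + 1) → Matrix.unitaryGroup (Fin m × Fin d) ℂ) => Mdag m d v p.1 (K p.2) :=
        Continuous.Mdag v continuous_fst ((continuous_chain v h k).comp continuous_snd)
      exact (hM.matrix_mul hM).matrix_trace.sub ((hM.matrix_trace.pow 2).div_const _)
    have hfi : Integrable f (μ.prod (Measure.pi fun _ : Fin (k + 1) => μ)) :=
      hfc.integrable_of_hasCompactSupport (HasCompactSupport.of_compactSpace f)
    have hmp := measurePreserving_piFinSuccAbove (fun _ : Fin (k + 2) => μ) (Fin.last (k + 1))
    calc _ = ∫ W, f (MeasurableEquiv.piFinSuccAbove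
            (fun _ : Fin (k + 2) => Matrix.unitaryGroup (Fin m × Fin d) ℂ) (Fin.last (k + 1)) W)
            ∂(Measure.pi fun _ : Fin (k + 2) => μ) := by
          refine integral_congr_ae (ae_of_all _ fun W => ?_)
          have hW : (MeasurableEquiv.piFinSuccAbove
              (fun _ : Fin (k + 2) => Matrix.unitaryGroup (Fin m × Fin d) ℂ)
              (Fin.last (k + 1)) W) = (W (Fin.last (k + 1)), Fin.init W) := by
            refine Prod.ext rfl (funext fun j => ?_)
            exact congrArg W (Fin.succAbove_last_apply j)
          simp only [hW]
          rfl
      _ = ∫ p, f p ∂(μ.prod (Measure.pi fun _ : Fin (k + 1) => μ)) := hmp.integral_comp' f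
      _ = ∫ W, ∫ U, f (U, W) ∂μ ∂(Measure.pi fun _ : Fin (k + 1) => μ) := integral_prod_symm f hfi
      _ = ∫ W, ((m : ℂ) ^ 2 - 1) / (((m : ℂ) * d) ^ 2 - 1) *
            (d * ((K W * K W).trace - (K W).trace ^ 2 / (m : ℂ)))
            ∂(Measure.pi fun _ : Fin (k + 1) => μ) := by
          refine integral_congr_ae (ae_of_all _ fun W => ?_)
          have hX : (K W ⊗ₖ (1 : Matrix (Fin d) (Fin d) ℂ)).IsHermitian := by
            rw [IsHermitian, conjTranspose_kronecker, conjTranspose_one,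
              (isHermitian_chain v hh (k + 1) W).eq]
          have key := integral_variance_compression hmd μ hv hX
          rw [trace_kronecker_one_sq_sub hd] at key
          exact key
      _ = _ := by
          rw [integral_const_mul, integral_const_mul, ih]
          ring

end Chain

/-- For independent Haar unitaries `U_i, …, U_{j−1} ∈ U(md)`, a traceless Hermitian single-site
operator `h`, and `Y = (M†_{j−1} ∘ ⋯ ∘ M†_{i+1}(L)) ⊗ 1_d` with
`L = ⟨0_d|U_i†(1_m ⊗ h)U_i|0_d⟩`:
`E[Tr(Y²) − (Tr Y)²/(md)] = m Tr(h²) η^{j−i}` with `η = (1 − 1/m²)/(d − 1/(m²d))`. -/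
theorem average_Y_moment (hm : 1 ≤ m) (hd : 1 ≤ d) (hmd : 2 ≤ m * d)
    (μ : Measure (Matrix.unitaryGroup (Fin m × Fin d) ℂ))
    [μ.IsHaarMeasure] [IsProbabilityMeasure μ]
    (v : Fin d → ℂ) (hv : ∑ s, ‖v s‖ ^ 2 = 1)
    (h : Matrix (Fin d) (Fin d) ℂ) (hh : h.IsHermitian) (hh0 : h.trace = 0)
    (i j : ℕ) (hij : i < j) :
    (∫ W, ((fun Y : Matrix (Fin m × Fin d) (Fin m × Fin d) ℂ =>
          (Y * Y).trace - (Y.trace) ^ 2 / ((m : ℂ) * d))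
        ((chain m d v h (j - i) W) ⊗ₖ (1 : Matrix (Fin d) (Fin d) ℂ)))
        ∂(Measure.pi fun _ : Fin (j - i) => μ))
      = (m : ℂ) * (h * h).trace *
          ((1 - 1 / (m : ℂ) ^ 2) / ((d : ℂ) - 1 / ((m : ℂ) ^ 2 * d))) ^ (j - i) := by
  have hm' : (m : ℂ) ≠ 0 := Nat.cast_ne_zero.mpr (by omega)
  have hd' : (d : ℂ) ≠ 0 := Nat.cast_ne_zero.mpr (by omega)
  obtain ⟨k, hk⟩ : ∃ k, j - i = k + 1 := ⟨j - i - 1, by omega⟩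
  rw [hk]
  simp only [trace_kronecker_one_sq_sub hd']
  rw [integral_const_mul, integral_variance_chain hmd μ hv hh hh0 k]
  have hη : (1 - 1 / (m : ℂ) ^ 2) / ((d : ℂ) - 1 / ((m : ℂ) ^ 2 * d)) =
      ((m : ℂ) ^ 2 - 1) / (((m : ℂ) * d) ^ 2 - 1) * d := by
    have h1 : 1 - 1 / (m : ℂ) ^ 2 = ((m : ℂ) ^ 2 - 1) / (m : ℂ) ^ 2 := by field_simp
    have h2 : (d : ℂ) - 1 / ((m : ℂ) ^ 2 * d) = (((m : ℂ) * d) ^ 2 - 1) / ((m : ℂ) ^ 2 * d) := by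
      field_simp
    rw [h1, h2]
    field_simp
  rw [hη]
  generalize ((m : ℂ) ^ 2 - 1) / (((m : ℂ) * d) ^ 2 - 1) = q
  ring

end MPSChain
end

section
/- Let m ≥ 1 and d ≥ 2 be integers with md ≥ 2, let h be a Hermitian operator on ℂ^d ⊗ ℂ^d with Tr h = 0, let |0_d⟩ be a fixed unit vector in ℂ^d, and let U_i and U_{i+1} be independent Haar-random elements of U(md) acting on ℂ^m ⊗ ℂ^d. For a unitary U ∈ U(md) define the isometry A_U := U (1_m ⊗ |0_d⟩) : ℂ^m → ℂ^m ⊗ ℂ^d and the matrices A_U^s := (1_m ⊗ ⟨s|) A_U for s ∈ {1,…,d}. Define the operator L on ℂ^m by L := Σ_{s,t,s',t'} ⟨s',t'| h |s,t⟩ · A_{U_{i+1}}^{t'†} A_{U_i}^{s'†} A_{U_i}^{s} A_{U_{i+1}}^{t}. Then the Haar expectation satisfies E[ L ⊗ L ] = (1/(d²(m²d²−1)²)) · ( [ (m²d−1)·Tr(h²) + m²(d−1)·Tr((Tr₁ h)²) ] · ( md·Swap − 1_{m²} ) + m(d−1)·Tr((Tr₂ h)²) · ( md·1_{m²} − Swap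 ) ), where Swap is the operator on ℂ^m ⊗ ℂ^m with Swap(|α⟩⊗|β⟩) = |β⟩⊗|α⟩ and 1_{m²} is the identity on ℂ^m ⊗ ℂ^m. -/
open Matrix MeasureTheory
open scoped Kronecker

namespace MPSnn

variable (m d : ℕ)

/-- The isometric embedding `1_m ⊗ |0_d⟩ : ℂ^m → ℂ^m ⊗ ℂ^d`. -/
noncomputable def embed (v : Fin d → ℂ) : Matrix (Fin m × Fin d) (Fin m) ℂ :=
  fun p a => if p.1 = a then v p.2 else 0

/-- The isometry `A_U = U (1_m ⊗ |0_d⟩)`. -/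
noncomputable def isoA (v : Fin d → ℂ) (U : Matrix.unitaryGroup (Fin m × Fin d) ℂ) :
    Matrix (Fin m × Fin d) (Fin m) ℂ :=
  (U : Matrix (Fin m × Fin d) (Fin m × Fin d) ℂ) * embed m d v

/-- The matrix slice `A_U^s = (1_m ⊗ ⟨s|) A_U`. -/
noncomputable def slice (v : Fin d → ℂ) (U : Matrix.unitaryGroup (Fin m × Fin d) ℂ)
    (s : Fin d) : Matrix (Fin m) (Fin m) ℂ :=
  fun a b => isoA m d v U (a, s) b

/-- The two-site Hamiltonian term contracted with two left-orthonormal MPS tensors: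
`L = Σ_{s,t,s',t'} ⟨s',t'|h|s,t⟩ A_{U'}^{t'†} A_U^{s'†} A_U^{s} A_{U'}^{t}`. -/
noncomputable def Lnn (v : Fin d → ℂ) (h : Matrix (Fin d × Fin d) (Fin d × Fin d) ℂ)
    (U U' : Matrix.unitaryGroup (Fin m × Fin d) ℂ) : Matrix (Fin m) (Fin m) ℂ :=
  ∑ s : Fin d, ∑ t : Fin d, ∑ s' : Fin d, ∑ t' : Fin d,
    h (s', t') (s, t) •
      ((slice m d v U' t')ᴴ * (slice m d v U s')ᴴ * slice m d v U s * slice m d v U' t)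

/-- The swap operator on `ℂ^m ⊗ ℂ^m`. -/
def swapOp (m : ℕ) : Matrix (Fin m × Fin m) (Fin m × Fin m) ℂ :=
  fun p q => if p.1 = q.2 ∧ p.2 = q.1 then 1 else 0

/-- Partial trace of `h` over the first `ℂ^d` factor. -/
noncomputable def ptr1 (h : Matrix (Fin d × Fin d) (Fin d × Fin d) ℂ) :
    Matrix (Fin d) (Fin d) ℂ :=
  fun i j => ∑ a : Fin d, h (a, i) (a, j)

/-- Partial trace of `h` over the second `ℂ^d` factor. -/
noncomputable def ptr2 (h : Matrix (Fin d × Fin d) (Fin d × Fin d) ℂ) :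
    Matrix (Fin d) (Fin d) ℂ :=
  fun i j => ∑ b : Fin d, h (i, b) (j, b)

section Twirl

/-- The matrix element `⟨p, r| p', r'⟩` of the identity on a twofold tensor product. -/
def pairDelta {ι : Type*} [DecidableEq ι] (p r p' r' : ι) : ℂ :=
  if p = p' ∧ r = r' then 1 else 0

variable {n : Type*} [Fintype n] [DecidableEq n]

/-- Invariance of a tensor with two upper and two lower indices under conjugation by `W ⊗ W`
for every unitary `W`. -/
def IsTwirlInvariant (T : n → n → n → n → ℂ) : Prop :=
  ∀ W ∈ Matrix.unitaryGroup n ℂ, ∀ p r p' r', T p r p' r' =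
    ∑ x, W p x * ∑ y, W r y * ∑ x', star (W p' x') * ∑ y', star (W r' y') * T x y x' y'

variable {T : n → n → n → n → ℂ}

lemma IsTwirlInvariant.phase (hT : IsTwirlInvariant T) (z : n → ℂ) (hz : ∀ x, z x * star (z x) = 1)
    (p r p' r' : n) :
    T p r p' r' = z p * (z r * (star (z p') * (star (z r') * T p r p' r'))) := by
  have h := hT (Matrix.diagonal z) (by
    rw [Matrix.mem_unitaryGroup_iff, Matrix.star_eq_conjTranspose, Matrix.diagonal_conjTranspose,
      Matrix.diagonal_mul_diagonal, ← Matrix.diagonal_one]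
    congr 1
    ext x
    exact hz x) p r p' r'
  simpa [Matrix.diagonal_apply, apply_ite (star : ℂ → ℂ), apply_ite (starRingEnd ℂ),
    ite_mul, Finset.sum_ite_eq] using h

lemma IsTwirlInvariant.perm (hT : IsTwirlInvariant T) (σ : Equiv.Perm n) (p r p' r' : n) :
    T p r p' r' = T (σ p) (σ r) (σ p') (σ r') := by
  have h := hT (Matrix.of fun x y => if σ x = y then 1 else 0) (by
    rw [Matrix.mem_unitaryGroup_iff]
    ext x y
    simp [Matrix.mul_apply, Matrix.one_apply, Matrix.star_apply, eq_comm]) p r p' r'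
  simpa [apply_ite (star : ℂ → ℂ), apply_ite (starRingEnd ℂ), ite_mul] using h

lemma IsTwirlInvariant.eq_of_ne_zero (hT : IsTwirlInvariant T) {p r p' r' : n}
    (h : T p r p' r' ≠ 0) : (p = p' ∧ r = r') ∨ (p = r' ∧ r = p') := by
  have key (x : n) : (if p = x then Complex.I else 1) * ((if r = x then Complex.I else 1) *
      ((if p' = x then -Complex.I else 1) * (if r' = x then -Complex.I else 1))) = 1 := by
    have h1 := hT.phase (fun y => if y = x then Complex.I else 1)
      (by intro y; split_ifs <;> simp) p r p' r'
    apply mul_right_cancel₀ h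
    rw [one_mul]
    conv_rhs => rw [h1]
    simp only [apply_ite (star : ℂ → ℂ), Complex.star_def, Complex.conj_I, map_one]
    ring
  have hI : Complex.I ≠ 1 := by intro h; simpa using congrArg Complex.im h
  have hI' : (-1 : ℂ) ≠ 1 := by norm_num
  have kp := key p
  have kr := key r
  by_cases h1 : p = p'
  · subst h1
    left
    refine ⟨rfl, ?_⟩
    by_contra h2
    rw [if_pos rfl, if_neg (Ne.symm h2)] at kr
    by_cases h3 : p = r
    · simp [h3, hI] at kr
    · simp [h3, hI] at kr
  · by_cases h2 : p = r'
    · subst h2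
      right
      refine ⟨rfl, ?_⟩
      by_contra h3
      rw [if_pos rfl, if_neg (Ne.symm h3)] at kr
      by_cases h3 : p = r
      · simp [h3, hI] at kr
      · simp [h3, hI] at kr
    · exfalso
      rw [if_pos rfl, if_neg (Ne.symm h1), if_neg (Ne.symm h2)] at kp
      by_cases h3 : r = p
      · simp [h3, hI'] at kp
      · simp [h3, hI] at kp

lemma IsTwirlInvariant.diag (hT : IsTwirlInvariant T) {i j : n} (hij : i ≠ j) :
    T i i i i = T i j i j + T i j j i := by
  set w : n → ℂ := fun x => if x = i then 3 / 5 else if x = j then 4 / 5 else 0 with hw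
  have wi : w i = 3 / 5 := by simp [hw]
  have wj : w j = 4 / 5 := by simp [hw, hij.symm]
  have wstar (x : n) : star (w x) = w x := by
    simp only [hw]; split_ifs <;> simp
  have wsum (f : n → ℂ) : ∑ x, w x * f x = 3 / 5 * f i + 4 / 5 * f j := by
    rw [Finset.sum_eq_add i j hij]
    · rw [wi, wj]
    · rintro c - ⟨h1, h2⟩
      simp [hw, h1, h2]
    · simp
    · simp
  have wsum' (c : ℂ) (f : n → ℂ) :
      ∑ x, c * w x * f x = c * (3 / 5 * f i + 4 / 5 * f j) := by
    rw [← wsum, Finset.mul_sum]; simp only [mul_assoc]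
  have ww : ∑ x, w x * w x = 1 := by rw [wsum, wi, wj]; norm_num
  have h := hT (Matrix.of fun x y => (if x = y then 1 else 0) - 2 * w x * w y) (by
    rw [Matrix.mem_unitaryGroup_iff]
    ext x y
    simp only [Matrix.mul_apply, Matrix.star_apply, Matrix.of_apply, star_sub, star_mul', wstar,
      star_ofNat, apply_ite (star : ℂ → ℂ), star_one, star_zero, sub_mul, mul_sub,
      Finset.sum_sub_distrib, Matrix.one_apply]
    have : ∑ z, 2 * w x * w z * (2 * w y * w z) = 4 * w x * w y := by
      rw [← mul_one (4 * w x * w y), ← ww, Finset.mul_sum]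
      exact Finset.sum_congr rfl fun z _ => by ring
    rw [this]
    simp [eq_comm]
    ring) i i i i
  have Wsum (f : n → ℂ) : ∑ y, ((if i = y then 1 else 0) - 2 * w i * w y) * f y
      = 7 / 25 * f i - 24 / 25 * f j := by
    simp only [sub_mul, Finset.sum_sub_distrib]
    rw [wsum', wi]
    simp
    ring
  simp only [Matrix.of_apply, star_sub, star_mul', wstar, star_ofNat,
    apply_ite (star : ℂ → ℂ), star_one, star_zero, Wsum] at h
  have z {p r p' r' : n} (h : ¬ ((p = p' ∧ r = r') ∨ (p = r' ∧ r = p'))) : T p r p' r' = 0 := by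
    by_contra h'
    exact h (hT.eq_of_ne_zero h')
  rw [z (p := i) (r := i) (p' := i) (r' := j) (by grind),
    z (p := i) (r := i) (p' := j) (r' := i) (by grind),
    z (p := i) (r := i) (p' := j) (r' := j) (by grind),
    z (p := i) (r := j) (p' := i) (r' := i) (by grind),
    z (p := i) (r := j) (p' := j) (r' := j) (by grind),
    z (p := j) (r := i) (p' := i) (r' := i) (by grind),
    z (p := j) (r := i) (p' := j) (r' := j) (by grind),
    z (p := j) (r := j) (p' := i) (r' := i) (by grind),
    z (p := j) (r := j) (p' := i) (r' := j) (by grind),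
    z (p := j) (r := j) (p' := j) (r' := i) (by grind)] at h
  have e1 := hT.perm (Equiv.swap i j) i i i i
  have e2 := hT.perm (Equiv.swap i j) i j i j
  have e3 := hT.perm (Equiv.swap i j) i j j i
  simp only [Equiv.swap_apply_left, Equiv.swap_apply_right] at e1 e2 e3
  rw [← e1, ← e2, ← e3] at h
  linear_combination (625 * 625 / (2 * 49 * 576)) * h

/-- A tensor invariant under all `W ⊗ W` is a combination of the identity and the swap. -/
lemma IsTwirlInvariant.exists_eq [Nontrivial n] (hT : IsTwirlInvariant T) :
    ∃ α β : ℂ, ∀ p r p' r', T p r p' r' =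
      α * (if p = p' ∧ r = r' then 1 else 0) + β * (if p = r' ∧ r = p' then 1 else 0) := by
  obtain ⟨i, j, hij⟩ := exists_pair_ne n
  have move {p r : n} (hpr : p ≠ r) : ∃ σ : Equiv.Perm n, σ p = i ∧ σ r = j := by
    refine ⟨(Equiv.swap p i).trans (Equiv.swap (Equiv.swap p i r) j), ?_, by simp⟩
    have : i ≠ Equiv.swap p i r := by
      intro h
      apply hpr
      apply (Equiv.swap p i).injective
      rw [← h, Equiv.swap_apply_left]
    simp [Equiv.swap_apply_of_ne_of_ne this hij]
  have hα {p r : n} (hpr : p ≠ r) : T p r p r = T i j i j := by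
    obtain ⟨σ, h1, h2⟩ := move hpr
    rw [hT.perm σ, h1, h2]
  have hβ {p r : n} (hpr : p ≠ r) : T p r r p = T i j j i := by
    obtain ⟨σ, h1, h2⟩ := move hpr
    rw [hT.perm σ, h1, h2]
  refine ⟨T i j i j, T i j j i, fun p r p' r' => ?_⟩
  by_cases h0 : T p r p' r' = 0
  · by_cases h1 : p = p' ∧ r = r'
    · obtain ⟨rfl, rfl⟩ := h1
      by_cases hpr : p = r
      · subst hpr
        obtain ⟨k, hk⟩ := exists_ne p
        rw [hT.diag hk.symm, hα hk.symm, hβ hk.symm]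
        simp
      · rw [hα hpr]
        simp [hpr]
    · by_cases h2 : p = r' ∧ r = p'
      · obtain ⟨rfl, rfl⟩ := h2
        have hpr : p ≠ r := by rintro rfl; simp at h1
        rw [hβ hpr]
        simp [hpr]
      · rw [if_neg h1, if_neg h2, h0]; simp
  · rcases hT.eq_of_ne_zero h0 with ⟨rfl, rfl⟩ | ⟨rfl, rfl⟩
    · by_cases hpr : p = r
      · subst hpr
        obtain ⟨k, hk⟩ := exists_ne p
        rw [hT.diag hk.symm, hα hk.symm, hβ hk.symm]
        simp
      · rw [hα hpr]
        simp [hpr]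
    · by_cases hpr : p = r
      · subst hpr
        obtain ⟨k, hk⟩ := exists_ne p
        rw [hT.diag hk.symm, hα hk.symm, hβ hk.symm]
        simp
      · rw [hβ hpr]
        simp [hpr]

end Twirl

section Haar

variable {n : Type*} [Fintype n] [DecidableEq n]

lemma isCompact_unitaryGroup : IsCompact (Matrix.unitaryGroup n ℂ : Set (Matrix n n ℂ)) := by
  have hc : IsCompact (Set.pi Set.univ fun _ : n => Set.pi Set.univ fun _ : n =>
      Metric.closedBall (0 : ℂ) 1) :=
    isCompact_univ_pi fun _ => isCompact_univ_pi fun _ => isCompact_closedBall _ _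
  refine IsCompact.of_isClosed_subset hc isClosed_unitary fun U hU => ?_
  exact fun i _ j _ => mem_closedBall_zero_iff.mpr (entry_norm_bound_of_unitary hU i j)

instance : CompactSpace (Matrix.unitaryGroup n ℂ) :=
  isCompact_iff_compactSpace.mp isCompact_unitaryGroup

instance : SecondCountableTopology (Matrix.unitaryGroup n ℂ) :=
  haveI : SecondCountableTopology (Matrix n n ℂ) :=
    inferInstanceAs (SecondCountableTopology (n → n → ℂ))
  TopologicalSpace.Subtype.secondCountableTopology (Matrix.unitaryGroup n ℂ : Set (Matrix n n ℂ))

@[fun_prop]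
lemma continuous_unitaryGroup_mulVec (a : n → ℂ) (p : n) :
    Continuous fun U : Matrix.unitaryGroup n ℂ => ((U : Matrix n n ℂ) *ᵥ a) p := by
  simp only [Matrix.mulVec, dotProduct]
  refine continuous_finsetSum _ fun x _ => Continuous.mul ?_ continuous_const
  exact (continuous_subtype_val : Continuous fun U : Matrix.unitaryGroup n ℂ => U.1).matrix_elem p x

lemma sum_star_mulVec_mul_mulVec (U : Matrix.unitaryGroup n ℂ) (a b : n → ℂ) :
    ∑ p, star (((U : Matrix n n ℂ) *ᵥ a) p) * ((U : Matrix n n ℂ) *ᵥ b) p = star a ⬝ᵥ b := by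
  have h : star ((U : Matrix n n ℂ) *ᵥ a) ⬝ᵥ ((U : Matrix n n ℂ) *ᵥ b) = star a ⬝ᵥ b := by
    rw [Matrix.star_mulVec, ← Matrix.dotProduct_mulVec, Matrix.mulVec_mulVec,
      ← Matrix.star_eq_conjTranspose, Matrix.UnitaryGroup.star_mul_self, Matrix.one_mulVec]
  exact h

variable (μ : Measure (Matrix.unitaryGroup n ℂ)) [μ.IsHaarMeasure]

/-- The integrand of the second moment of a Haar-random unitary applied to fixed vectors. -/
noncomputable def moment (a b a' b' : n → ℂ) (p r p' r' : n) (U : Matrix.unitaryGroup n ℂ) : ℂ :=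
  ((U : Matrix n n ℂ) *ᵥ a) p * ((U : Matrix n n ℂ) *ᵥ b) r *
    star (((U : Matrix n n ℂ) *ᵥ a') p') * star (((U : Matrix n n ℂ) *ᵥ b') r')

lemma integrable_of_continuous {f : Matrix.unitaryGroup n ℂ → ℂ} (hf : Continuous f) :
    Integrable f μ :=
  hf.integrable_of_hasCompactSupport (HasCompactSupport.of_compactSpace f)

@[fun_prop]
lemma continuous_moment (a b a' b' : n → ℂ) (p r p' r' : n) :
    Continuous (moment a b a' b' p r p' r') := by
  unfold moment
  fun_prop

lemma isTwirlInvariant_integral_moment (a b a' b' : n → ℂ) :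
    IsTwirlInvariant fun p r p' r' => ∫ U, moment a b a' b' p r p' r' U ∂μ := by
  intro W hW p r p' r'
  have expand (V U : Matrix.unitaryGroup n ℂ) : moment a b a' b' p r p' r' (V * U) =
      ∑ x, ∑ y, ∑ x', ∑ y', (V : Matrix n n ℂ) p x * (V : Matrix n n ℂ) r y *
        star ((V : Matrix n n ℂ) p' x') * star ((V : Matrix n n ℂ) r' y') *
        moment a b a' b' x y x' y' U := by
    have hV (c : n → ℂ) (q : n) : (((V * U : Matrix.unitaryGroup n ℂ) : Matrix n n ℂ) *ᵥ c) q =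
        ∑ x, (V : Matrix n n ℂ) q x * ((U : Matrix n n ℂ) *ᵥ c) x := by
      rw [Matrix.UnitaryGroup.mul_val, ← Matrix.mulVec_mulVec]
      rfl
    simp only [moment, hV, star_sum, star_mul', mul_assoc]
    simp only [Finset.sum_mul]
    simp only [Finset.mul_sum]
    refine Finset.sum_congr rfl fun x _ => Finset.sum_congr rfl fun y _ =>
      Finset.sum_congr rfl fun x' _ => Finset.sum_congr rfl fun y' _ => ?_
    ring
  lift W to Matrix.unitaryGroup n ℂ using hW
  beta_reduce
  rw [← integral_mul_left_eq_self _ W]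
  simp_rw [expand]
  simp only [Finset.mul_sum]
  rw [integral_finsetSum _ fun x _ => integrable_of_continuous μ (by fun_prop)]
  refine Finset.sum_congr rfl fun x _ => ?_
  rw [integral_finsetSum _ fun x _ => integrable_of_continuous μ (by fun_prop)]
  refine Finset.sum_congr rfl fun y _ => ?_
  rw [integral_finsetSum _ fun x _ => integrable_of_continuous μ (by fun_prop)]
  refine Finset.sum_congr rfl fun x' _ => ?_
  rw [integral_finsetSum _ fun x _ => integrable_of_continuous μ (by fun_prop)]
  refine Finset.sum_congr rfl fun y' _ => ?_
  rw [integral_const_mul]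
  ring

/-- The second moment of a Haar-random unitary matrix applied to fixed vectors. -/
lemma integral_moment [IsProbabilityMeasure μ] [Nontrivial n] (a b a' b' : n → ℂ) (p r p' r' : n) :
    ∫ U, moment a b a' b' p r p' r' U ∂μ =
      1 / ((Fintype.card n : ℂ) ^ 2 - 1) *
        ((pairDelta p r p' r' - 1 / (Fintype.card n : ℂ) * pairDelta p r r' p') *
            ((star a' ⬝ᵥ a) * (star b' ⬝ᵥ b)) +
          (pairDelta p r r' p' - 1 / (Fintype.card n : ℂ) * pairDelta p r p' r') *
            ((star b' ⬝ᵥ a) * (star a' ⬝ᵥ b))) := by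
  unfold pairDelta
  obtain ⟨α, β, h⟩ := (isTwirlInvariant_integral_moment μ a b a' b').exists_eq
  have i1 (p r p' r' : n) : Integrable (moment a b a' b' p r p' r') μ :=
    integrable_of_continuous μ (continuous_moment ..)
  have h1 : ∑ p, ∑ r, ∫ U, moment a b a' b' p r p r U ∂μ = (star a' ⬝ᵥ a) * (star b' ⬝ᵥ b) := by
    simp_rw [← integral_finsetSum _ fun r _ => i1 _ r _ r]
    rw [← integral_finsetSum _ fun p _ => integrable_finsetSum _ fun r _ => i1 p r p r]
    have (U : Matrix.unitaryGroup n ℂ) : ∑ p, ∑ r, moment a b a' b' p r p r U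
        = (star a' ⬝ᵥ a) * (star b' ⬝ᵥ b) := by
      rw [← sum_star_mulVec_mul_mulVec U, ← sum_star_mulVec_mul_mulVec U, Finset.sum_mul_sum]
      exact Finset.sum_congr rfl fun _ _ => Finset.sum_congr rfl fun _ _ => by
        unfold moment; ring
    simp [this]
  have h2 : ∑ p, ∑ r, ∫ U, moment a b a' b' p r r p U ∂μ = (star b' ⬝ᵥ a) * (star a' ⬝ᵥ b) := by
    simp_rw [← integral_finsetSum _ fun r _ => i1 _ r r _]
    rw [← integral_finsetSum _ fun p _ => integrable_finsetSum _ fun r _ => i1 p r r p]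
    have (U : Matrix.unitaryGroup n ℂ) : ∑ p, ∑ r, moment a b a' b' p r r p U
        = (star b' ⬝ᵥ a) * (star a' ⬝ᵥ b) := by
      rw [← sum_star_mulVec_mul_mulVec U, ← sum_star_mulVec_mul_mulVec U, Finset.sum_mul_sum]
      exact Finset.sum_congr rfl fun _ _ => Finset.sum_congr rfl fun _ _ => by
        unfold moment; ring
    simp [this]
  have hc : 2 ≤ Fintype.card n := Fintype.one_lt_card
  have hc0 : (Fintype.card n : ℂ) ≠ 0 := by
    exact_mod_cast (by omega : Fintype.card n ≠ 0)
  have hc1 : (Fintype.card n : ℂ) ^ 2 - 1 ≠ 0 := by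
    rw [sub_ne_zero]
    exact_mod_cast (by nlinarith : Fintype.card n ^ 2 ≠ 1)
  have e (p r : n) : (p = r ∧ r = p) ↔ p = r := by grind
  simp only [h, e, Finset.sum_add_distrib, ← Finset.mul_sum] at h1 h2
  simp at h1 h2
  rw [h, ← h1, ← h2]
  field_simp
  ring

end Haar

section Contraction

lemma pairDelta_prod {ι κ : Type*} [DecidableEq ι] [DecidableEq κ] (a c a' c' : ι)
    (s r s' r' : κ) :
    pairDelta (a, s) (c, r) (a', s') (c', r') = pairDelta a c a' c' * pairDelta s r s' r' := by
  simp only [pairDelta, Prod.mk.injEq]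
  split_ifs <;> grind

lemma sum_sum_pairDelta_bond :
    ∑ b : Fin m × Fin m, ∑ e : Fin m × Fin m,
      pairDelta b.2 e.2 b.1 e.1 * pairDelta b.2 e.2 b.1 e.1 = (m : ℂ) ^ 2 := by
  simp [pairDelta, Fintype.sum_prod_type, ite_and, sq]

lemma sum_sum_pairDelta_bond_exchange :
    ∑ b : Fin m × Fin m, ∑ e : Fin m × Fin m,
      pairDelta b.2 e.2 e.1 b.1 * pairDelta b.2 e.2 e.1 b.1 = (m : ℂ) ^ 2 := by
  simp [pairDelta, Fintype.sum_prod_type, ite_and, sq]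

lemma sum_sum_pairDelta_bond_mixed :
    ∑ b : Fin m × Fin m, ∑ e : Fin m × Fin m,
      pairDelta b.2 e.2 b.1 e.1 * pairDelta b.2 e.2 e.1 b.1 = (m : ℂ) := by
  simp [pairDelta, Fintype.sum_prod_type, ite_and]

variable {d} (h : Matrix (Fin d × Fin d) (Fin d × Fin d) ℂ)

lemma sum_sum_direct_direct :
    ∑ x : (Fin d × Fin d) × (Fin d × Fin d), ∑ y : (Fin d × Fin d) × (Fin d × Fin d),
      h x.1 x.2 * h y.1 y.2 * (pairDelta x.2.1 y.2.1 x.1.1 y.1.1 *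
        pairDelta x.2.2 y.2.2 x.1.2 y.1.2) = h.trace * h.trace := by
  simp only [← pairDelta_prod, Prod.mk.eta]
  simp [pairDelta, Fintype.sum_prod_type (α₁ := Fin d × Fin d) (α₂ := Fin d × Fin d), ite_and,
    Matrix.trace, Finset.sum_mul_sum]

lemma sum_sum_exchange_exchange :
    ∑ x : (Fin d × Fin d) × (Fin d × Fin d), ∑ y : (Fin d × Fin d) × (Fin d × Fin d),
      h x.1 x.2 * h y.1 y.2 * (pairDelta x.2.1 y.2.1 y.1.1 x.1.1 *
        pairDelta x.2.2 y.2.2 y.1.2 x.1.2) = (h * h).trace := by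
  simp only [← pairDelta_prod, Prod.mk.eta]
  simp [pairDelta, Fintype.sum_prod_type (α₁ := Fin d × Fin d) (α₂ := Fin d × Fin d), ite_and,
    Matrix.trace, Matrix.mul_apply]

lemma sum_sum_direct_exchange :
    ∑ x : (Fin d × Fin d) × (Fin d × Fin d), ∑ y : (Fin d × Fin d) × (Fin d × Fin d),
      h x.1 x.2 * h y.1 y.2 * (pairDelta x.2.1 y.2.1 x.1.1 y.1.1 *
        pairDelta x.2.2 y.2.2 y.1.2 x.1.2) = (ptr1 d h * ptr1 d h).trace := by
  simp [pairDelta, Fintype.sum_prod_type, ite_and, Matrix.trace, Matrix.mul_apply, ptr1,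
    Finset.sum_mul_sum]
  rw [Finset.sum_comm]
  exact Finset.sum_congr rfl fun _ _ => Finset.sum_comm

lemma sum_sum_exchange_direct :
    ∑ x : (Fin d × Fin d) × (Fin d × Fin d), ∑ y : (Fin d × Fin d) × (Fin d × Fin d),
      h x.1 x.2 * h y.1 y.2 * (pairDelta x.2.1 y.2.1 y.1.1 x.1.1 *
        pairDelta x.2.2 y.2.2 x.1.2 y.1.2) = (ptr2 d h * ptr2 d h).trace := by
  simp [pairDelta, Fintype.sum_prod_type, ite_and, Matrix.trace, Matrix.mul_apply, ptr2,
    Finset.sum_mul_sum]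
  exact Finset.sum_congr rfl fun _ _ => Finset.sum_comm

lemma sum_sum_prod_mul {π β : Type*} [Fintype π] [Fintype β] (P : π → π → ℂ) (B : β → β → ℂ) :
    ∑ k : π × β, ∑ l : π × β, P k.1 l.1 * B k.2 l.2 =
      (∑ x, ∑ y, P x y) * ∑ b, ∑ e, B b e := by
  simp only [Fintype.sum_prod_type, Finset.sum_mul_sum]

end Contraction

section Slices

variable {m d} (v : Fin d → ℂ)

lemma star_embed_dotProduct_embed (hv : ∑ s, ‖v s‖ ^ 2 = 1) (b' b : Fin m) :
    (star fun x => embed m d v x b') ⬝ᵥ (fun x => embed m d v x b) = if b = b' then 1 else 0 := by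
  have hv' : ∑ s, star (v s) * v s = 1 := by
    simp only [Complex.star_def, Complex.conj_mul']
    exact_mod_cast hv
  simp only [dotProduct, Pi.star_apply, embed, Fintype.sum_prod_type]
  split_ifs with hb
  · subst hb
    simpa using hv'
  · refine Finset.sum_eq_zero fun x _ => Finset.sum_eq_zero fun y _ => ?_
    split_ifs <;> simp_all

lemma slice_apply (U : Matrix.unitaryGroup (Fin m × Fin d) ℂ) (s : Fin d) (a b : Fin m) :
    slice m d v U s a b = ((U : Matrix (Fin m × Fin d) (Fin m × Fin d) ℂ) *ᵥ
      fun x => embed m d v x b) (a, s) :=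
  rfl

@[fun_prop]
lemma continuous_slice (s : Fin d) (a b : Fin m) :
    Continuous fun U => slice m d v U s a b := by
  simp only [slice_apply]
  fun_prop

variable (μ : Measure (Matrix.unitaryGroup (Fin m × Fin d) ℂ)) [μ.IsHaarMeasure]

lemma integral_slice [IsProbabilityMeasure μ] (hmd : 2 ≤ m * d) (hv : ∑ s, ‖v s‖ ^ 2 = 1)
    (s r s' r' : Fin d) (a c a' c' b e b' e' : Fin m) :
    ∫ U, slice m d v U s a b * slice m d v U r c e * star (slice m d v U s' a' b') *
        star (slice m d v U r' c' e') ∂μ =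
      1 / (((m : ℂ) * d) ^ 2 - 1) *
        ((pairDelta a c a' c' * pairDelta s r s' r' -
            1 / ((m : ℂ) * d) * (pairDelta a c c' a' * pairDelta s r r' s')) *
            pairDelta b e b' e' +
          (pairDelta a c c' a' * pairDelta s r r' s' -
            1 / ((m : ℂ) * d) * (pairDelta a c a' c' * pairDelta s r s' r')) *
            pairDelta b e e' b') := by
  have : Nontrivial (Fin m × Fin d) := by
    rw [← Fintype.one_lt_card_iff_nontrivial]
    simpa using Nat.lt_of_succ_le hmd
  have hcol (x y x' y' : Fin m) : (if x = x' then 1 else 0) * (if y = y' then 1 else 0) =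
      pairDelta x y x' y' := by
    simp only [pairDelta]
    split_ifs <;> grind
  have key := integral_moment μ (fun x => embed m d v x b) (fun x => embed m d v x e)
    (fun x => embed m d v x b') (fun x => embed m d v x e') (a, s) (c, r) (a', s') (c', r')
  simp only [star_embed_dotProduct_embed v hv, hcol, pairDelta_prod, Fintype.card_prod,
    Fintype.card_fin, Nat.cast_mul] at key
  exact key

/-- The matrix elements of `(A_U^{s'})† A_U^s`. -/
noncomputable def overlap (U : Matrix.unitaryGroup (Fin m × Fin d) ℂ) (s' s : Fin d)
    (b' b : Fin m) : ℂ :=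
  ∑ a, star (slice m d v U s' a b') * slice m d v U s a b

@[fun_prop]
lemma continuous_overlap (s' s : Fin d) (b' b : Fin m) :
    Continuous fun U => overlap v U s' s b' b := by
  unfold overlap
  fun_prop

lemma integral_overlap_mul_overlap [IsProbabilityMeasure μ] (hmd : 2 ≤ m * d)
    (hv : ∑ s, ‖v s‖ ^ 2 = 1)
    (s r s' r' : Fin d) (b e b' e' : Fin m) :
    ∫ U, overlap v U s' s b' b * overlap v U r' r e' e ∂μ =
      1 / (((m : ℂ) * d) ^ 2 - 1) *
        (((m : ℂ) ^ 2 * pairDelta s r s' r' - 1 / ((m : ℂ) * d) * (m * pairDelta s r r' s')) *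
            pairDelta b e b' e' +
          (m * pairDelta s r r' s' - 1 / ((m : ℂ) * d) * ((m : ℂ) ^ 2 * pairDelta s r s' r')) *
            pairDelta b e e' b') := by
  have expand (U : Matrix.unitaryGroup (Fin m × Fin d) ℂ) :
      overlap v U s' s b' b * overlap v U r' r e' e = ∑ a, ∑ c,
        slice m d v U s a b * slice m d v U r c e * star (slice m d v U s' a b') *
          star (slice m d v U r' c e') := by
    unfold overlap
    rw [Finset.sum_mul_sum]
    exact Finset.sum_congr rfl fun _ _ => Finset.sum_congr rfl fun _ _ => by ring
  simp_rw [expand]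
  rw [integral_finsetSum _ fun a _ => integrable_of_continuous μ (by fun_prop)]
  have (a : Fin m) := integral_finsetSum (μ := μ) Finset.univ
    (f := fun c U => slice m d v U s a b * slice m d v U r c e * star (slice m d v U s' a b') *
          star (slice m d v U r' c e')) fun c _ => integrable_of_continuous μ (by fun_prop)
  simp_rw [this, integral_slice v μ hmd hv]
  have h1 : ∑ a : Fin m, ∑ c : Fin m, pairDelta a c a c = (m : ℂ) ^ 2 := by
    simp [pairDelta, sq]
  have h2 : ∑ a : Fin m, ∑ c : Fin m, pairDelta a c c a = (m : ℂ) := by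
    simp [pairDelta, ite_and]
  rw [← h1, Finset.sum_congr rfl fun a _ => Finset.sum_congr rfl fun c _ =>
    show _ = (1 / (((m : ℂ) * d) ^ 2 - 1) * ((pairDelta s r s' r') * pairDelta b e b' e' -
        1 / ((m : ℂ) * d) * pairDelta s r s' r' * pairDelta b e e' b')) * pairDelta a c a c +
      (1 / (((m : ℂ) * d) ^ 2 - 1) * (pairDelta s r r' s' * pairDelta b e e' b' -
        1 / ((m : ℂ) * d) * pairDelta s r r' s' * pairDelta b e b' e')) * pairDelta a c c a by ring]
  simp only [Finset.sum_add_distrib, ← Finset.mul_sum, h2]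
  ring

lemma Lnn_apply (h : Matrix (Fin d × Fin d) (Fin d × Fin d) ℂ)
    (U U' : Matrix.unitaryGroup (Fin m × Fin d) ℂ) (β α : Fin m) :
    Lnn m d v h U U' β α =
      ∑ k : ((Fin d × Fin d) × (Fin d × Fin d)) × (Fin m × Fin m), h k.1.1 k.1.2 *
        (overlap v U k.1.1.1 k.1.2.1 k.2.1 k.2.2 *
          (star (slice m d v U' k.1.1.2 k.2.1 β) * slice m d v U' k.1.2.2 k.2.2 α)) := by
  have hmul (s t s' t' : Fin d) : ((slice m d v U' t')ᴴ * (slice m d v U s')ᴴ * slice m d v U s *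
      slice m d v U' t) β α = ∑ b', ∑ b, overlap v U s' s b' b *
        (star (slice m d v U' t' b' β) * slice m d v U' t b α) := by
    rw [Matrix.mul_assoc (slice m d v U' t')ᴴ, Matrix.mul_apply, Finset.sum_comm]
    refine Finset.sum_congr rfl fun b _ => ?_
    rw [Matrix.mul_apply, Finset.sum_mul]
    refine Finset.sum_congr rfl fun b' _ => ?_
    simp only [overlap, Matrix.mul_apply, Matrix.conjTranspose_apply]
    ring
  simp only [Lnn, Matrix.sum_apply, Matrix.smul_apply, hmul, smul_eq_mul, Finset.mul_sum]
  conv_rhs => rw [Fintype.sum_prod_type, Fintype.sum_prod_type, Finset.sum_comm]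
  simp only [Fintype.sum_prod_type]

lemma integral_sum_mul_sum {κ : Type*} [Fintype κ] (c : κ → ℂ)
    (F G G' : κ → Matrix.unitaryGroup (Fin m × Fin d) ℂ → ℂ) (hF : ∀ k, Continuous (F k))
    (hG : ∀ k, Continuous (G k)) (hG' : ∀ k, Continuous (G' k)) :
    ∫ W, (∑ k, c k * (F k W.1 * G k W.2)) * (∑ l, c l * (F l W.1 * G' l W.2)) ∂(μ.prod μ) =
      ∑ k, ∑ l, c k * c l * ((∫ U, F k U * F l U ∂μ) * ∫ U, G k U * G' l U ∂μ) := by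
  have hi (f : Matrix.unitaryGroup (Fin m × Fin d) ℂ × Matrix.unitaryGroup (Fin m × Fin d) ℂ → ℂ)
      (hf : Continuous f) : Integrable f (μ.prod μ) :=
    hf.integrable_of_hasCompactSupport (HasCompactSupport.of_compactSpace f)
  simp_rw [Finset.sum_mul_sum]
  rw [integral_finsetSum _ fun k _ => hi _ (by fun_prop)]
  refine Finset.sum_congr rfl fun k _ => ?_
  rw [integral_finsetSum _ fun l _ => hi _ (by fun_prop)]
  refine Finset.sum_congr rfl fun l _ => ?_
  rw [← integral_prod_mul, ← integral_const_mul]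
  congr 1
  ext W
  ring

end Slices
/-- Haar average of `L ⊗ L` for the two-site Hamiltonian term contracted with two independent
Haar-random left-orthonormal MPS tensors:
`E[L⊗L] = (1/(d²(m²d²−1)²)) ( [(m²d−1)Tr(h²) + m²(d−1)Tr((Tr₁h)²)] (md·Swap − 1)
+ m(d−1)Tr((Tr₂h)²) (md·1 − Swap) )`. -/
theorem average_Lnn_tensor_Lnn (hm : 1 ≤ m) (hd : 2 ≤ d) (hmd : 2 ≤ m * d)
    (μ : Measure (Matrix.unitaryGroup (Fin m × Fin d) ℂ))
    [μ.IsHaarMeasure] [IsProbabilityMeasure μ]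
    (v : Fin d → ℂ) (hv : ∑ s, ‖v s‖ ^ 2 = 1)
    (h : Matrix (Fin d × Fin d) (Fin d × Fin d) ℂ) (hh : h.IsHermitian) (hh0 : h.trace = 0)
    (p q : Fin m × Fin m) :
    ∫ W : Matrix.unitaryGroup (Fin m × Fin d) ℂ × Matrix.unitaryGroup (Fin m × Fin d) ℂ,
        ((Lnn m d v h W.1 W.2) ⊗ₖ (Lnn m d v h W.1 W.2)) p q ∂(μ.prod μ)
      = ((1 / ((d : ℂ) ^ 2 * ((m : ℂ) ^ 2 * (d : ℂ) ^ 2 - 1) ^ 2)) •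
          ((((m : ℂ) ^ 2 * (d : ℂ) - 1) * (h * h).trace
              + (m : ℂ) ^ 2 * ((d : ℂ) - 1) * (ptr1 d h * ptr1 d h).trace) •
            (((m : ℂ) * (d : ℂ)) • swapOp m - (1 : Matrix (Fin m × Fin m) (Fin m × Fin m) ℂ))
          + ((m : ℂ) * ((d : ℂ) - 1) * (ptr2 d h * ptr2 d h).trace) •
            (((m : ℂ) * (d : ℂ)) • (1 : Matrix (Fin m × Fin m) (Fin m × Fin m) ℂ) - swapOp m)))
        p q := by
  have hm0 : (m : ℂ) ≠ 0 := by exact_mod_cast (by omega : m ≠ 0)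
  have hd0 : (d : ℂ) ≠ 0 := by exact_mod_cast (by omega : d ≠ 0)
  have hD1 : (m : ℂ) ^ 2 * (d : ℂ) ^ 2 - 1 ≠ 0 := by
    rw [sub_ne_zero, ← mul_pow]
    exact_mod_cast (by nlinarith : (m * d) ^ 2 ≠ 1)
  simp only [Matrix.kroneckerMap_apply, Lnn_apply]
  rw [integral_sum_mul_sum μ
    (fun k : ((Fin d × Fin d) × (Fin d × Fin d)) × (Fin m × Fin m) => h k.1.1 k.1.2)
    (fun k U => overlap v U k.1.1.1 k.1.2.1 k.2.1 k.2.2)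
    (fun k U => star (slice m d v U k.1.1.2 k.2.1 p.1) * slice m d v U k.1.2.2 k.2.2 q.1)
    (fun k U => star (slice m d v U k.1.1.2 k.2.1 p.2) * slice m d v U k.1.2.2 k.2.2 q.2)
    (fun k => by fun_prop) (fun k => by fun_prop) (fun k => by fun_prop)]
  have hG (t u t' u' : Fin d) (b e b' e' : Fin m) :
      ∫ U, star (slice m d v U t' b' p.1) * slice m d v U t b q.1 *
        (star (slice m d v U u' e' p.2) * slice m d v U u e q.2) ∂μ =
      1 / (((m : ℂ) * d) ^ 2 - 1) *
        ((pairDelta b e b' e' * pairDelta t u t' u' -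
            1 / ((m : ℂ) * d) * (pairDelta b e e' b' * pairDelta t u u' t')) *
            pairDelta q.1 q.2 p.1 p.2 +
          (pairDelta b e e' b' * pairDelta t u u' t' -
            1 / ((m : ℂ) * d) * (pairDelta b e b' e' * pairDelta t u t' u')) *
            pairDelta q.1 q.2 p.2 p.1) := by
    rw [← integral_slice v μ hmd hv]
    congr 1
    ext U
    ring
  simp only [integral_overlap_mul_overlap v μ hmd hv, hG]
  have h1 : (1 : Matrix (Fin m × Fin m) (Fin m × Fin m) ℂ) p q = pairDelta q.1 q.2 p.1 p.2 := by
    simp only [Matrix.one_apply, pairDelta, Prod.ext_iff]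
    split_ifs <;> grind
  have h2 : swapOp m p q = pairDelta q.1 q.2 p.2 p.1 := by
    simp only [swapOp, pairDelta]
    split_ifs <;> grind
  simp only [Matrix.smul_apply, Matrix.add_apply, Matrix.sub_apply, smul_eq_mul, h1, h2]
  generalize pairDelta q.1 q.2 p.1 p.2 = C₁
  generalize pairDelta q.1 q.2 p.2 p.1 = C₂
  obtain ⟨Pdd, hPdd⟩ : ∃ P : (Fin d × Fin d) × (Fin d × Fin d) →
      (Fin d × Fin d) × (Fin d × Fin d) → ℂ, ∀ x y, P x y = h x.1 x.2 * h y.1 y.2 *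
        (pairDelta x.2.1 y.2.1 x.1.1 y.1.1 * pairDelta x.2.2 y.2.2 x.1.2 y.1.2) :=
    ⟨_, fun _ _ => rfl⟩
  have sPdd : ∑ x, ∑ y, Pdd x y = h.trace * h.trace := by
    simp only [hPdd]
    exact sum_sum_direct_direct h
  obtain ⟨Pee, hPee⟩ : ∃ P : (Fin d × Fin d) × (Fin d × Fin d) →
      (Fin d × Fin d) × (Fin d × Fin d) → ℂ, ∀ x y, P x y = h x.1 x.2 * h y.1 y.2 *
        (pairDelta x.2.1 y.2.1 y.1.1 x.1.1 * pairDelta x.2.2 y.2.2 y.1.2 x.1.2) :=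
    ⟨_, fun _ _ => rfl⟩
  have sPee : ∑ x, ∑ y, Pee x y = (h * h).trace := by
    simp only [hPee]
    exact sum_sum_exchange_exchange h
  obtain ⟨Pde, hPde⟩ : ∃ P : (Fin d × Fin d) × (Fin d × Fin d) →
      (Fin d × Fin d) × (Fin d × Fin d) → ℂ, ∀ x y, P x y = h x.1 x.2 * h y.1 y.2 *
        (pairDelta x.2.1 y.2.1 x.1.1 y.1.1 * pairDelta x.2.2 y.2.2 y.1.2 x.1.2) :=
    ⟨_, fun _ _ => rfl⟩
  have sPde : ∑ x, ∑ y, Pde x y = (ptr1 d h * ptr1 d h).trace := by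
    simp only [hPde]
    exact sum_sum_direct_exchange h
  obtain ⟨Ped, hPed⟩ : ∃ P : (Fin d × Fin d) × (Fin d × Fin d) →
      (Fin d × Fin d) × (Fin d × Fin d) → ℂ, ∀ x y, P x y = h x.1 x.2 * h y.1 y.2 *
        (pairDelta x.2.1 y.2.1 y.1.1 x.1.1 * pairDelta x.2.2 y.2.2 x.1.2 y.1.2) :=
    ⟨_, fun _ _ => rfl⟩
  have sPed : ∑ x, ∑ y, Ped x y = (ptr2 d h * ptr2 d h).trace := by
    simp only [hPed]
    exact sum_sum_exchange_direct h
  obtain ⟨Bdd, hBdd⟩ : ∃ B : Fin m × Fin m → Fin m × Fin m → ℂ, ∀ b e, B b e =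
      pairDelta b.2 e.2 b.1 e.1 * pairDelta b.2 e.2 b.1 e.1 := ⟨_, fun _ _ => rfl⟩
  have sBdd : ∑ b, ∑ e, Bdd b e = (m : ℂ) ^ 2 := by
    simp only [hBdd]
    exact sum_sum_pairDelta_bond m
  obtain ⟨Bee, hBee⟩ : ∃ B : Fin m × Fin m → Fin m × Fin m → ℂ, ∀ b e, B b e =
      pairDelta b.2 e.2 e.1 b.1 * pairDelta b.2 e.2 e.1 b.1 := ⟨_, fun _ _ => rfl⟩
  have sBee : ∑ b, ∑ e, Bee b e = (m : ℂ) ^ 2 := by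
    simp only [hBee]
    exact sum_sum_pairDelta_bond_exchange m
  obtain ⟨Bde, hBde⟩ : ∃ B : Fin m × Fin m → Fin m × Fin m → ℂ, ∀ b e, B b e =
      pairDelta b.2 e.2 b.1 e.1 * pairDelta b.2 e.2 e.1 b.1 := ⟨_, fun _ _ => rfl⟩
  have sBde : ∑ b, ∑ e, Bde b e = (m : ℂ) := by
    simp only [hBde]
    exact sum_sum_pairDelta_bond_mixed m
  obtain ⟨D, hD⟩ : ∃ D : ℂ, D = (m : ℂ) * d := ⟨_, rfl⟩
  obtain ⟨κ, hκ⟩ : ∃ κ : ℂ, κ = 1 / (D ^ 2 - 1) := ⟨_, rfl⟩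
  obtain ⟨g₁, hg₁⟩ : ∃ g : ℂ, g = C₁ - C₂ / D := ⟨_, rfl⟩
  obtain ⟨g₂, hg₂⟩ : ∃ g : ℂ, g = C₂ - C₁ / D := ⟨_, rfl⟩
  rw [← hD, ← hκ, Finset.sum_congr rfl fun k _ => Finset.sum_congr rfl fun l _ => show _ =
      κ ^ 2 * (m ^ 2 * g₁) * (Pdd k.1 l.1 * Bdd k.2 l.2) +
      κ ^ 2 * (-(m / D) * g₁) * (Ped k.1 l.1 * Bdd k.2 l.2) +
      κ ^ 2 * (m ^ 2 * g₂) * (Pde k.1 l.1 * Bde k.2 l.2) +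
      κ ^ 2 * (-(m / D) * g₂) * (Pee k.1 l.1 * Bde k.2 l.2) +
      κ ^ 2 * (m * g₁) * (Ped k.1 l.1 * Bde k.2 l.2) +
      κ ^ 2 * (-(m ^ 2 / D) * g₁) * (Pdd k.1 l.1 * Bde k.2 l.2) +
      κ ^ 2 * (m * g₂) * (Pee k.1 l.1 * Bee k.2 l.2) +
      κ ^ 2 * (-(m ^ 2 / D) * g₂) * (Pde k.1 l.1 * Bee k.2 l.2) by
    simp only [hPdd, hPee, hPde, hPed, hBdd, hBee, hBde, hg₁, hg₂]
    ring]
  simp only [Finset.sum_add_distrib, ← Finset.mul_sum, sum_sum_prod_mul, sPdd, sPee, sPde, sPed,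
    sBdd, sBee, sBde, hh0]
  rw [hκ, hg₁, hg₂, hD, mul_pow]
  field_simp
  ring

end MPSnn
end

section
/- Let χ ≥ 2 be an integer. Define ν₊(k) := k(k+1)/2 and ν₋(k) := k(k−1)/2 for positive integers k; the column vectors a := (1,0)ᵀ and t := (1,1)ᵀ in ℝ²; the 2×4 matrix S with rows (1,0,0,1) and (0,1,1,0); and for positive integers χ₁, χ₂ the 4×2 matrix J(χ₁,χ₂) whose first column is ( ν₊(χ₁)ν₊(χ₂)/ν₊(χ₁χ₂), 0, 0, ν₋(χ₁)ν₋(χ₂)/ν₊(χ₁χ₂) )ᵀ and whose second column is ( 0, ν₊(χ₁)ν₋(χ₂)/ν₋(χ₁χ₂), ν₋(χ₁)ν₊(χ₂)/ν₋(χ₁χ₂), 0 )ᵀ. Set G := J(χ,χ)·S (a 4×4 matrix). Define the 8×8 matrices E_R := ( tᵀ ⊗ tᵀ ⊗ 1₈ ⊗ tᵀ ) · ( 1₂ ⊗ G ⊗ G ⊗ 1₂ ) · ( G ⊗ G ⊗ G ) · ( 1₂ ⊗ a ⊗ 1₂ ⊗ a ⊗ 1₂ ⊗ a ) and E_L :=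 ( tᵀ ⊗ 1₂ ⊗ 1₂ ⊗ 1₂ ⊗ tᵀ ⊗ tᵀ ) · ( 1₂ ⊗ G ⊗ G ⊗ 1₂ ) · ( G ⊗ G ⊗ G ) · ( 1₂ ⊗ a ⊗ 1₂ ⊗ a ⊗ 1₂ ⊗ a ), where ⊗ is the Kronecker product and 1₂, 1₈ are identity matrices. Then both E_R and E_L have characteristic polynomial x⁴ (x − 1) (x − χ²(1+χ)²/(1+χ²)³) (x − χ³(1+χ)²/(1+χ²)⁴) (x − χ³/(1+χ²)³); i.e. their eigenvalues (with multiplicity) are 1, χ²(1+χ)²/(1+χ²)³, χ³(1+χ)²/(1+χ²)⁴, χ³/(1+χ²)³, and 0 with multiplicity four. -/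
open Matrix Polynomial

namespace MERAbin

/-- `ν₊(k) = k(k+1)/2`. -/
noncomputable def nup (k : ℕ) : ℝ := (k : ℝ) * ((k : ℝ) + 1) / 2

/-- `ν₋(k) = k(k−1)/2`. -/
noncomputable def num (k : ℕ) : ℝ := (k : ℝ) * ((k : ℝ) - 1) / 2

/-- The vector `a = (1,0)ᵀ` (appending an auxiliary doubled site in the reference state). -/
noncomputable def avec : Fin 2 → ℝ := ![1, 0]

/-- The vector `t = (1,1)ᵀ` (tracing out a doubled site). -/
noncomputable def tvec : Fin 2 → ℝ := ![1, 1]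

/-- The `2×4` matrix `S` with rows `(1,0,0,1)` and `(0,1,1,0)`; columns are indexed by pairs
in the order `(+,+), (+,−), (−,+), (−,−)`. -/
noncomputable def Smat : Matrix (Fin 2) (Fin 2 × Fin 2) ℝ :=
  fun r c => if (r = 0 ∧ c.1 = c.2) ∨ (r = 1 ∧ c.1 ≠ c.2) then 1 else 0

/-- The `4×2` matrix `J(χ₁,χ₂)`; rows are indexed by pairs in the order
`(+,+), (+,−), (−,+), (−,−)`. -/
noncomputable def Jmat (χ₁ χ₂ : ℕ) : Matrix (Fin 2 × Fin 2) (Fin 2) ℝ :=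
  fun r c =>
    if c = 0 then
      if r = ((0 : Fin 2), (0 : Fin 2)) then nup χ₁ * nup χ₂ / nup (χ₁ * χ₂)
      else if r = ((1 : Fin 2), (1 : Fin 2)) then num χ₁ * num χ₂ / nup (χ₁ * χ₂)
      else 0
    else
      if r = ((0 : Fin 2), (1 : Fin 2)) then nup χ₁ * num χ₂ / num (χ₁ * χ₂)
      else if r = ((1 : Fin 2), (0 : Fin 2)) then num χ₁ * nup χ₂ / num (χ₁ * χ₂)
      else 0

/-- `G = J(χ,χ) · S`: the doubled fully depolarizing channel on two doubled sites. -/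
noncomputable def Gmat (χ : ℕ) : Matrix (Fin 2 × Fin 2) (Fin 2 × Fin 2) ℝ :=
  Jmat χ χ * Smat

/-- The six-site space `(c₁,a₁,c₂,a₂,c₃,a₃)`. -/
abbrev V6 : Type := Fin 2 × Fin 2 × Fin 2 × Fin 2 × Fin 2 × Fin 2

/-- The three-site space. -/
abbrev V3 : Type := Fin 2 × Fin 2 × Fin 2

/-- `1₂ ⊗ a ⊗ 1₂ ⊗ a ⊗ 1₂ ⊗ a` : appending the auxiliary sites `a₁, a₂, a₃`. -/
noncomputable def appendAux : Matrix V6 V3 ℝ :=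
  fun v x =>
    (if v.1 = x.1 then 1 else 0) * avec v.2.1 *
      (if v.2.2.1 = x.2.1 then 1 else 0) * avec v.2.2.2.1 *
      (if v.2.2.2.2.1 = x.2.2 then 1 else 0) * avec v.2.2.2.2.2

/-- `G_{c₁,a₁} ⊗ G_{c₂,a₂} ⊗ G_{c₃,a₃}` : the isometry layer. -/
noncomputable def isoLayer (χ : ℕ) : Matrix V6 V6 ℝ :=
  fun v w =>
    Gmat χ (v.1, v.2.1) (w.1, w.2.1) *
      Gmat χ (v.2.2.1, v.2.2.2.1) (w.2.2.1, w.2.2.2.1) *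
      Gmat χ (v.2.2.2.2.1, v.2.2.2.2.2) (w.2.2.2.2.1, w.2.2.2.2.2)

/-- `1₂ ⊗ G_{a₁,c₂} ⊗ G_{a₂,c₃} ⊗ 1₂` : the disentangler layer. -/
noncomputable def disLayer (χ : ℕ) : Matrix V6 V6 ℝ :=
  fun v w =>
    (if v.1 = w.1 then 1 else 0) *
      Gmat χ (v.2.1, v.2.2.1) (w.2.1, w.2.2.1) *
      Gmat χ (v.2.2.2.1, v.2.2.2.2.1) (w.2.2.2.1, w.2.2.2.2.1) *
      (if v.2.2.2.2.2 = w.2.2.2.2.2 then 1 else 0)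

/-- `tᵀ ⊗ tᵀ ⊗ 1₈ ⊗ tᵀ` : tracing out sites `c₁, a₁, a₃`, keeping `(c₂,a₂,c₃)`. -/
noncomputable def traceR : Matrix V3 V6 ℝ :=
  fun x v =>
    tvec v.1 * tvec v.2.1 *
      (if x.1 = v.2.2.1 then 1 else 0) * (if x.2.1 = v.2.2.2.1 then 1 else 0) *
      (if x.2.2 = v.2.2.2.2.1 then 1 else 0) * tvec v.2.2.2.2.2

/-- `tᵀ ⊗ 1₈ ⊗ tᵀ ⊗ tᵀ` : tracing out sites `c₁, c₃, a₃`, keeping `(a₁,c₂,a₂)`. -/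
noncomputable def traceL : Matrix V3 V6 ℝ :=
  fun x v =>
    tvec v.1 *
      (if x.1 = v.2.1 then 1 else 0) * (if x.2.1 = v.2.2.1 then 1 else 0) *
      (if x.2.2 = v.2.2.2.1 then 1 else 0) *
      tvec v.2.2.2.2.1 * tvec v.2.2.2.2.2

/-- The right-moving doubled layer-transition matrix `E_R` of the binary 1D MERA. -/
noncomputable def ER (χ : ℕ) : Matrix V3 V3 ℝ :=
  traceR * disLayer χ * isoLayer χ * appendAux

/-- The left-moving doubled layer-transition matrix `E_L` of the binary 1D MERA. -/
noncomputable def EL (χ : ℕ) : Matrix V3 V3 ℝ :=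
  traceL * disLayer χ * isoLayer χ * appendAux

/-- The entries of `J(χ,χ)` in terms of the parameter `d = χ/(1+χ²)`. -/
noncomputable def isoEntry (d : ℝ) (b c y : Fin 2) : ℝ :=
  if y = 0 then (if b = c then (if b = 0 then 1 / 2 + d else 1 / 2 - d) else 0)
  else if b = c then 0 else 1 / 2

lemma Jmat_self (χ : ℕ) (hχ : 2 ≤ χ) (r : Fin 2 × Fin 2) (y : Fin 2) :
    Jmat χ χ r y = isoEntry ((χ : ℝ) / (1 + (χ : ℝ) ^ 2)) r.1 r.2 y := by
  have h2 : (2 : ℝ) ≤ χ := by exact_mod_cast hχ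
  have h0 : (χ : ℝ) ≠ 0 := by positivity
  have hp : 1 + (χ : ℝ) ^ 2 ≠ 0 := by positivity
  have hm : (χ : ℝ) ^ 2 - 1 ≠ 0 := by nlinarith
  obtain ⟨b, c⟩ := r
  fin_cases b <;> fin_cases c <;> fin_cases y <;>
    simp [Jmat, isoEntry, nup, num, ← pow_two] <;> field_simp <;> ring

/-- The isometries applied to three sites, each with a fresh auxiliary site. -/
noncomputable def isoBlock (d : ℝ) : Matrix V6 V3 ℝ :=
  fun v y => isoEntry d v.1 v.2.1 y.1 * isoEntry d v.2.2.1 v.2.2.2.1 y.2.1 *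
    isoEntry d v.2.2.2.2.1 v.2.2.2.2.2 y.2.2

/-- The factor `tᵀ ⊗ S ⊗ S ⊗ tᵀ` of the disentangler layer. -/
noncomputable def disInput : Matrix (Fin 2 × Fin 2) V6 ℝ :=
  fun u w => Smat u.1 (w.2.1, w.2.2.1) * Smat u.2 (w.2.2.2.1, w.2.2.2.2.1)

/-- The depolarizing output `J ⊗ J` with the leftmost site traced out. -/
noncomputable def outR (d : ℝ) : Matrix V3 (Fin 2 × Fin 2) ℝ :=
  fun x u => (∑ b, isoEntry d b x.1 u.1) * isoEntry d x.2.1 x.2.2 u.2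

/-- The depolarizing output `J ⊗ J` with the rightmost site traced out. -/
noncomputable def outL (d : ℝ) : Matrix V3 (Fin 2 × Fin 2) ℝ :=
  fun x u => isoEntry d x.1 x.2.1 u.1 * ∑ b, isoEntry d x.2.2 b u.2

lemma avec_apply (i : Fin 2) : avec i = if i = 0 then 1 else 0 := by
  fin_cases i <;> rfl

lemma tvec_apply (i : Fin 2) : tvec i = 1 := by
  fin_cases i <;> rfl

lemma Gmat_apply_zero (χ : ℕ) (r : Fin 2 × Fin 2) (y : Fin 2) :
    Gmat χ r (y, 0) = Jmat χ χ r y := by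
  fin_cases y <;> simp [Gmat, mul_apply, Smat]

lemma isoLayer_mul_appendAux (χ : ℕ) (hχ : 2 ≤ χ) :
    isoLayer χ * appendAux = isoBlock ((χ : ℝ) / (1 + (χ : ℝ) ^ 2)) := by
  ext v y
  simp [mul_apply, Fintype.sum_prod_type, isoLayer, appendAux, avec_apply, Gmat_apply_zero,
    Jmat_self χ hχ, isoBlock]

lemma traceR_mul_disLayer (χ : ℕ) (hχ : 2 ≤ χ) :
    traceR * disLayer χ = outR ((χ : ℝ) / (1 + (χ : ℝ) ^ 2)) * disInput := by
  ext x w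
  simp [mul_apply, Fintype.sum_prod_type, traceR, disLayer, tvec_apply, Gmat,
    Jmat_self χ hχ, outR, disInput]
  ring

lemma traceL_mul_disLayer (χ : ℕ) (hχ : 2 ≤ χ) :
    traceL * disLayer χ = outL ((χ : ℝ) / (1 + (χ : ℝ) ^ 2)) * disInput := by
  ext x w
  simp [mul_apply, Fintype.sum_prod_type, traceL, disLayer, tvec_apply, Gmat,
    Jmat_self χ hχ, outL, disInput]
  ring

/-- The compression of the transition matrices to the four-dimensional space of
block symmetries. -/
noncomputable def core (d : ℝ) : Matrix (Fin 4) (Fin 4) ℝ :=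
  !![1 / 4 + d ^ 2 + 3 * d ^ 3 + 2 * d ^ 4, 1 / 4, 1 / 4 + d ^ 2 + 2 * d ^ 3, 1 / 4;
     1 / 4 - d ^ 2 / 2 - d ^ 3, 1 / 4 + d ^ 2 / 2 + d ^ 3, 1 / 4 - d ^ 2 / 2 - d ^ 3,
       1 / 4 + d ^ 2 / 2;
     1 / 4 - d ^ 3 - 2 * d ^ 4, 1 / 4, 1 / 4, 1 / 4;
     1 / 4 - d ^ 2 / 2 - d ^ 3, 1 / 4 - d ^ 2 / 2 - d ^ 3, 1 / 4 - d ^ 2 / 2 - d ^ 3,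
       1 / 4 - d ^ 2 / 2]

lemma charpoly_core (d : ℝ) :
    (core d).charpoly = (X - C 1) * (X - C (d ^ 2 * (1 + 2 * d))) *
      (X - C (d ^ 3 * (1 + 2 * d))) * (X - C (d ^ 3)) := by
  refine Polynomial.funext fun x => ?_
  rw [Matrix.eval_charpoly]
  simp [core, det_succ_row_zero, Fin.sum_univ_succ, Fin.succAbove]
  ring

lemma disInput_mul_isoBlock (d : ℝ) (u : Fin 2 × Fin 2) (y : V3) :
    (disInput * isoBlock d) u y = ∑ c, ∑ e,
      (∑ b, isoEntry d b (u.1 + c) y.1) * isoEntry d c e y.2.1 *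
        ∑ b, isoEntry d (u.2 + e) b y.2.2 := by
  obtain ⟨u₁, u₂⟩ := u
  fin_cases u₁ <;> fin_cases u₂ <;>
    simp [mul_apply, Fintype.sum_prod_type, disInput, isoBlock, Smat] <;> ring

lemma charpoly_outR (d : ℝ) :
    (disInput * isoBlock d * outR d).charpoly = (core d).charpoly := by
  rw [← charpoly_reindex finProdFinEquiv]
  congr 1
  ext i j
  fin_cases i <;> fin_cases j <;>
    simp [core, finProdFinEquiv, mul_apply (M := disInput * isoBlock d),
      disInput_mul_isoBlock, Fintype.sum_prod_type, outR, isoEntry, Fin.divNat, Fin.modNat] <;>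
    ring

lemma charpoly_outL (d : ℝ) :
    (disInput * isoBlock d * outL d).charpoly = (core d).charpoly := by
  rw [← charpoly_reindex ((Equiv.prodComm _ _).trans finProdFinEquiv)]
  congr 1
  ext i j
  fin_cases i <;> fin_cases j <;>
    simp [core, finProdFinEquiv, mul_apply (M := disInput * isoBlock d),
      disInput_mul_isoBlock, Fintype.sum_prod_type, outL, isoEntry, Fin.divNat, Fin.modNat] <;>
    ring

lemma charpoly_mul_eq (A : Matrix V3 (Fin 2 × Fin 2) ℝ) (B : Matrix (Fin 2 × Fin 2) V3 ℝ) :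
    (A * B).charpoly = X ^ 4 * (B * A).charpoly := by
  simpa using charpoly_mul_comm_of_le A B (by simp)

/-- The spectra of the right- and left-moving doubled layer-transition channels of the binary
1D MERA: both `E_R` and `E_L` have characteristic polynomial
`x⁴ (x−1) (x − χ²(1+χ)²/(1+χ²)³) (x − χ³(1+χ)²/(1+χ²)⁴) (x − χ³/(1+χ²)³)`. -/
theorem charpoly_ER_EL (χ : ℕ) (hχ : 2 ≤ χ) :
    (ER χ).charpoly
        = X ^ 4 * (X - C 1) *
            (X - C ((χ : ℝ) ^ 2 * (1 + (χ : ℝ)) ^ 2 / (1 + (χ : ℝ) ^ 2) ^ 3)) *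
            (X - C ((χ : ℝ) ^ 3 * (1 + (χ : ℝ)) ^ 2 / (1 + (χ : ℝ) ^ 2) ^ 4)) *
            (X - C ((χ : ℝ) ^ 3 / (1 + (χ : ℝ) ^ 2) ^ 3))
      ∧ (EL χ).charpoly
          = X ^ 4 * (X - C 1) *
              (X - C ((χ : ℝ) ^ 2 * (1 + (χ : ℝ)) ^ 2 / (1 + (χ : ℝ) ^ 2) ^ 3)) *
              (X - C ((χ : ℝ) ^ 3 * (1 + (χ : ℝ)) ^ 2 / (1 + (χ : ℝ) ^ 2) ^ 4)) *
              (X - C ((χ : ℝ) ^ 3 / (1 + (χ : ℝ) ^ 2) ^ 3)) := by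
  have hp : 1 + (χ : ℝ) ^ 2 ≠ 0 := by positivity
  have h₁ : (χ : ℝ) ^ 2 * (1 + (χ : ℝ)) ^ 2 / (1 + (χ : ℝ) ^ 2) ^ 3 =
      ((χ : ℝ) / (1 + (χ : ℝ) ^ 2)) ^ 2 * (1 + 2 * ((χ : ℝ) / (1 + (χ : ℝ) ^ 2))) := by
    field_simp
    ring
  have h₂ : (χ : ℝ) ^ 3 * (1 + (χ : ℝ)) ^ 2 / (1 + (χ : ℝ) ^ 2) ^ 4 =
      ((χ : ℝ) / (1 + (χ : ℝ) ^ 2)) ^ 3 * (1 + 2 * ((χ : ℝ) / (1 + (χ : ℝ) ^ 2))) := by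
    field_simp
    ring
  rw [h₁, h₂, ← div_pow, ER, EL, traceR_mul_disLayer χ hχ, traceL_mul_disLayer χ hχ,
    Matrix.mul_assoc _ (isoLayer χ), Matrix.mul_assoc _ (isoLayer χ),
    isoLayer_mul_appendAux χ hχ, Matrix.mul_assoc, Matrix.mul_assoc, charpoly_mul_eq,
    charpoly_mul_eq, charpoly_outR, charpoly_outL, charpoly_core]
  simp only [mul_assoc, and_self]

end MERAbin
end

section
/- Let χ ≥ 2 be an integer and let E_R and E_L be the 8×8 matrices defined as follows. Define ν₊(k) := k(k+1)/2 and ν₋(k) := k(k−1)/2 for positive integers k; the column vectors a := (1,0)ᵀ and t := (1,1)ᵀ in ℝ²; the 2×4 matrix S with rows (1,0,0,1) and (0,1,1,0); for positive integers χ₁, χ₂ the 4×2 matrix J(χ₁,χ₂) whose first column is ( ν₊(χ₁)ν₊(χ₂)/ν₊(χ₁χ₂), 0, 0, ν₋(χ₁)ν₋(χ₂)/ν₊(χ₁χ₂) )ᵀ and whose second column is ( 0, ν₊(χ₁)ν₋(χ₂)/ν₋(χ₁χ₂), ν₋(χ₁)ν₊(χ₂)/ν₋(χ₁χ₂), 0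 )ᵀ; and G := J(χ,χ)·S. Then E_R := ( tᵀ ⊗ tᵀ ⊗ 1₈ ⊗ tᵀ ) · ( 1₂ ⊗ G ⊗ G ⊗ 1₂ ) · ( G ⊗ G ⊗ G ) · ( 1₂ ⊗ a ⊗ 1₂ ⊗ a ⊗ 1₂ ⊗ a ) and E_L := ( tᵀ ⊗ 1₂ ⊗ 1₂ ⊗ 1₂ ⊗ tᵀ ⊗ tᵀ ) · ( 1₂ ⊗ G ⊗ G ⊗ 1₂ ) · ( G ⊗ G ⊗ G ) · ( 1₂ ⊗ a ⊗ 1₂ ⊗ a ⊗ 1₂ ⊗ a ). The average E := (E_L + E_R)/2 has characteristic polynomial x⁴ (x − 1) (x − η_bi) (x − λ₃) (x − λ₄), where η_bi := χ²(1+χ)⁴/(2(1+χ²)⁴), λ₃ := χ²(1+χ)²/(2(1+χ²)³), and λ₄ := χ³/(1+χ²)³; i.e. the eigenvalues of E (with multiplicity) are 1, η_bi, λ₃, λ₄, and 0 with multiplicity four. In particular the unique largest eigenvalue is 1 and the second largest eigenvalue in absolute value is η_bi = χ²(1+χ)⁴/(2(1+χ²)⁴). -/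
open Matrix Polynomial

namespace MERAbin

/-- The spatially averaged doubled layer-transition matrix `E = (E_L + E_R)/2` of the binary
1D MERA. -/
noncomputable def Eavg (χ : ℕ) : Matrix V3 V3 ℝ :=
  (1 / 2 : ℝ) • (EL χ + ER χ)

/-- The joint weight of the pair `(i, j)` given its parity `s`: the entries of `J(χ,χ)` as a
function of the parameter `c = 2χ/(1+χ²)`. -/
noncomputable def pairWeight (c : ℝ) (i j s : Fin 2) : ℝ :=
  if s = 0 then
    if i = 0 ∧ j = 0 then (1 + c) / 2 else if i = 1 ∧ j = 1 then (1 - c) / 2 else 0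
  else if i ≠ j then 1 / 2 else 0

/-- The marginal of `pairWeight` on one site. -/
noncomputable def siteWeight (c : ℝ) (i s : Fin 2) : ℝ :=
  if s = 0 then if i = 0 then (1 + c) / 2 else (1 - c) / 2 else 1 / 2

/-- The sign character of `Fin 2`. -/
noncomputable def sgn (s : Fin 2) : ℝ := if s = 0 then 1 else -1

/-- The four characters of the parity pair `(s, r)`. -/
noncomputable def parityChar (k : Fin 4) (s r : Fin 2) : ℝ :=
  ![1, sgn s, sgn r, sgn s * sgn r] k

/-- The expectation of each parity character after the isometry layer. -/
noncomputable def charRow (c : ℝ) : Matrix (Fin 4) V3 ℝ :=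
  fun k x =>
    ![1, if x.1 = 0 ∧ x.2.1 = 0 then c ^ 2 else 0, if x.2.1 = 0 ∧ x.2.2 = 0 then c ^ 2 else 0,
      if x.1 = 0 ∧ x.2.2 = 0 then c ^ 2 * sgn x.2.1 else 0] k

/-- The averaged output of the disentangler layer and the traces, given the parities. -/
noncomputable def outWeight (c : ℝ) (x : V3) (s r : Fin 2) : ℝ :=
  (siteWeight c x.1 s * pairWeight c x.2.1 x.2.2 r +
    pairWeight c x.1 x.2.1 s * siteWeight c x.2.2 r) / 2

/-- The Fourier coefficients of `outWeight` in the parities. -/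
noncomputable def charCol (c : ℝ) : Matrix V3 (Fin 4) ℝ :=
  fun x k => (∑ s, ∑ r, outWeight c x s r * parityChar k s r) / 4

/-- The layer transition in the basis of parity characters. -/
noncomputable def charTransition (c : ℝ) : Matrix (Fin 4) (Fin 4) ℝ :=
  !![1, 0, 0, 0;
    c ^ 2 * ((1 + c) / 4 + ((2 + c) / 4) ^ 2) / 2, c ^ 2 * ((1 + c) / 4 + c * (2 + c) / 16) / 2,
      c ^ 3 * (2 + c) / 32, c ^ 4 / 32;
    c ^ 2 * ((1 + c) / 4 + ((2 + c) / 4) ^ 2) / 2, c ^ 3 * (2 + c) / 32,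
      c ^ 2 * ((1 + c) / 4 + c * (2 + c) / 16) / 2, c ^ 4 / 32;
    c ^ 3 * (2 + c) / 16, c ^ 2 * (((2 + c) / 4) ^ 2 + c ^ 2 / 16) / 2,
      c ^ 2 * (((2 + c) / 4) ^ 2 + c ^ 2 / 16) / 2, c ^ 3 * (2 + c) / 16]

theorem Gmat_apply (χ : ℕ) (hχ : 2 ≤ χ) (i j k l : Fin 2) :
    Gmat χ (i, j) (k, l) = pairWeight (2 * χ / (1 + (χ : ℝ) ^ 2)) i j (k + l) := by
  have h : (2 : ℝ) ≤ χ := by exact_mod_cast hχ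
  have h₀ : (χ : ℝ) ≠ 0 := by positivity
  have h₃ : (χ : ℝ) * χ - 1 ≠ 0 := by nlinarith
  have e₁ : nup χ * nup χ / nup (χ * χ) = (1 + 2 * χ / (1 + (χ : ℝ) ^ 2)) / 2 := by
    simp only [nup, Nat.cast_mul]; field_simp; ring
  have e₂ : num χ * num χ / nup (χ * χ) = (1 - 2 * χ / (1 + (χ : ℝ) ^ 2)) / 2 := by
    simp only [nup, num, Nat.cast_mul]; field_simp; ring
  have e₃ : nup χ * num χ / num (χ * χ) = 1 / 2 := by
    have h₄ : num (χ * χ) ≠ 0 := by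
      simp only [num, Nat.cast_mul]; positivity
    rw [div_eq_iff h₄]
    simp only [nup, num, Nat.cast_mul]; ring
  have e₄ : num χ * nup χ / num (χ * χ) = 1 / 2 := by rw [mul_comm (num χ), e₃]
  simp only [Gmat, mul_apply, Fin.sum_univ_two, Jmat, Smat, e₁, e₂, e₃, e₄, pairWeight]
  fin_cases i <;> fin_cases j <;> fin_cases k <;> fin_cases l <;> simp

theorem isoLayer_mul_appendAux_apply (χ : ℕ) (hχ : 2 ≤ χ) (v : V6) (x : V3) :
    (isoLayer χ * appendAux) v x =
      pairWeight (2 * χ / (1 + (χ : ℝ) ^ 2)) v.1 v.2.1 x.1 *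
        pairWeight (2 * χ / (1 + (χ : ℝ) ^ 2)) v.2.2.1 v.2.2.2.1 x.2.1 *
        pairWeight (2 * χ / (1 + (χ : ℝ) ^ 2)) v.2.2.2.2.1 v.2.2.2.2.2 x.2.2 := by
  obtain ⟨x₁, x₂, x₃⟩ := x
  simp only [mul_apply, Fintype.sum_prod_type, isoLayer, appendAux, Gmat_apply χ hχ]
  fin_cases x₁ <;> fin_cases x₂ <;> fin_cases x₃ <;> simp [Fin.sum_univ_two, avec]

theorem sum_pairWeight_right (c : ℝ) (i s : Fin 2) :
    ∑ j, pairWeight c i j s = siteWeight c i s := by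
  fin_cases i <;> fin_cases s <;> simp [pairWeight, siteWeight]

theorem sum_pairWeight_left (c : ℝ) (j s : Fin 2) :
    ∑ i, pairWeight c i j s = siteWeight c j s := by
  fin_cases j <;> fin_cases s <;> simp [pairWeight, siteWeight]

theorem traceR_mul_disLayer_apply (χ : ℕ) (hχ : 2 ≤ χ) (x : V3) (w : V6) :
    (traceR * disLayer χ) x w =
      siteWeight (2 * χ / (1 + (χ : ℝ) ^ 2)) x.1 (w.2.1 + w.2.2.1) *
        pairWeight (2 * χ / (1 + (χ : ℝ) ^ 2)) x.2.1 x.2.2 (w.2.2.2.1 + w.2.2.2.2.1) := by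
  obtain ⟨x₁, x₂, x₃⟩ := x
  obtain ⟨w₁, w₂, w₃, w₄, w₅, w₆⟩ := w
  simp only [mul_apply, Fintype.sum_prod_type, traceR, disLayer, Gmat_apply χ hχ,
    ← sum_pairWeight_left]
  fin_cases x₁ <;> fin_cases x₂ <;> fin_cases x₃ <;> fin_cases w₁ <;> fin_cases w₆ <;>
    simp [Fin.sum_univ_two, tvec] <;> ring

theorem traceL_mul_disLayer_apply (χ : ℕ) (hχ : 2 ≤ χ) (x : V3) (w : V6) :
    (traceL * disLayer χ) x w =
      pairWeight (2 * χ / (1 + (χ : ℝ) ^ 2)) x.1 x.2.1 (w.2.1 + w.2.2.1) *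
        siteWeight (2 * χ / (1 + (χ : ℝ) ^ 2)) x.2.2 (w.2.2.2.1 + w.2.2.2.2.1) := by
  obtain ⟨x₁, x₂, x₃⟩ := x
  obtain ⟨w₁, w₂, w₃, w₄, w₅, w₆⟩ := w
  simp only [mul_apply, Fintype.sum_prod_type, traceL, disLayer, Gmat_apply χ hχ,
    ← sum_pairWeight_right]
  fin_cases x₁ <;> fin_cases x₂ <;> fin_cases x₃ <;> fin_cases w₁ <;> fin_cases w₆ <;>
    simp [Fin.sum_univ_two, tvec] <;> ring

set_option maxHeartbeats 2000000 in
theorem sum_outWeight_mul (c : ℝ) (x y : V3) :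
    ∑ v : V6, outWeight c x (v.2.1 + v.2.2.1) (v.2.2.2.1 + v.2.2.2.2.1) *
        (pairWeight c v.1 v.2.1 y.1 * pairWeight c v.2.2.1 v.2.2.2.1 y.2.1 *
          pairWeight c v.2.2.2.2.1 v.2.2.2.2.2 y.2.2) =
      (charCol c * charRow c) x y := by
  obtain ⟨y₁, y₂, y₃⟩ := y
  simp only [charCol, mul_apply]
  generalize outWeight c x = o
  fin_cases y₁ <;> fin_cases y₂ <;> fin_cases y₃ <;>
    simp [Fintype.sum_prod_type, Fin.sum_univ_two, Fin.sum_univ_four, charRow, parityChar,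
      pairWeight, sgn] <;> ring

theorem Eavg_eq (χ : ℕ) (hχ : 2 ≤ χ) :
    Eavg χ = charCol (2 * χ / (1 + (χ : ℝ) ^ 2)) * charRow (2 * χ / (1 + (χ : ℝ) ^ 2)) := by
  ext x y
  have h : Eavg χ = ((1 / 2 : ℝ) • (traceL * disLayer χ + traceR * disLayer χ)) *
      (isoLayer χ * appendAux) := by
    simp only [Eavg, EL, ER, Matrix.mul_assoc, Matrix.smul_mul, Matrix.add_mul]
  rw [h, ← sum_outWeight_mul, mul_apply]
  refine Finset.sum_congr rfl fun v _ => ?_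
  rw [isoLayer_mul_appendAux_apply χ hχ, Matrix.smul_apply, Matrix.add_apply,
    traceL_mul_disLayer_apply χ hχ, traceR_mul_disLayer_apply χ hχ, outWeight, smul_eq_mul]
  ring

set_option maxHeartbeats 2000000 in
theorem charRow_mul_charCol (c : ℝ) : charRow c * charCol c = charTransition c := by
  ext i j
  fin_cases i <;> fin_cases j <;>
    simp [mul_apply, Fintype.sum_prod_type, Fin.sum_univ_two, charRow, charCol, charTransition,
      parityChar, outWeight, pairWeight, siteWeight, sgn] <;> ring

theorem charpoly_charTransition (c : ℝ) :
    (charTransition c).charpoly =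
      (X - C 1) * (X - C (c ^ 2 * (1 + c) ^ 2 / 8)) * (X - C (c ^ 2 * (1 + c) / 8)) *
        (X - C (c ^ 3 / 8)) := by
  refine Polynomial.funext fun t => ?_
  rw [Matrix.eval_charpoly]
  simp [charTransition, det_succ_row_zero, Fin.sum_univ_succ, Fin.succAbove]
  ring

/-- The spectrum of the spatially averaged doubled layer-transition channel of the binary 1D
MERA: `E = (E_L + E_R)/2` has characteristic polynomial
`x⁴ (x−1) (x−η_bi) (x−λ₃) (x−λ₄)` with `η_bi = χ²(1+χ)⁴/(2(1+χ²)⁴)`,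
`λ₃ = χ²(1+χ)²/(2(1+χ²)³)`, `λ₄ = χ³/(1+χ²)³`; in particular the unique largest eigenvalue
is `1` and the second largest eigenvalue in absolute value is `η_bi`. -/
theorem charpoly_Eavg (χ : ℕ) (hχ : 2 ≤ χ) :
    (Eavg χ).charpoly
        = X ^ 4 * (X - C 1) *
            (X - C ((χ : ℝ) ^ 2 * (1 + (χ : ℝ)) ^ 4 / (2 * (1 + (χ : ℝ) ^ 2) ^ 4))) *
            (X - C ((χ : ℝ) ^ 2 * (1 + (χ : ℝ)) ^ 2 / (2 * (1 + (χ : ℝ) ^ 2) ^ 3))) *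
            (X - C ((χ : ℝ) ^ 3 / (1 + (χ : ℝ) ^ 2) ^ 3))
      ∧ (χ : ℝ) ^ 2 * (1 + (χ : ℝ)) ^ 4 / (2 * (1 + (χ : ℝ) ^ 2) ^ 4) < 1
      ∧ (χ : ℝ) ^ 2 * (1 + (χ : ℝ)) ^ 2 / (2 * (1 + (χ : ℝ) ^ 2) ^ 3)
          < (χ : ℝ) ^ 2 * (1 + (χ : ℝ)) ^ 4 / (2 * (1 + (χ : ℝ) ^ 2) ^ 4)
      ∧ (χ : ℝ) ^ 3 / (1 + (χ : ℝ) ^ 2) ^ 3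
          < (χ : ℝ) ^ 2 * (1 + (χ : ℝ)) ^ 4 / (2 * (1 + (χ : ℝ) ^ 2) ^ 4) := by
  have h : (2 : ℝ) ≤ χ := by exact_mod_cast hχ
  have h₁ : (0 : ℝ) < 1 + (χ : ℝ) ^ 2 := by positivity
  refine ⟨?_, ?_, ?_, ?_⟩
  · have key := Matrix.charpoly_mul_comm_of_le (charCol (2 * χ / (1 + (χ : ℝ) ^ 2)))
      (charRow (2 * χ / (1 + (χ : ℝ) ^ 2))) (by simp)
    rw [Eavg_eq χ hχ, key, charRow_mul_charCol, charpoly_charTransition]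
    have e₁ : (2 * χ / (1 + (χ : ℝ) ^ 2)) ^ 2 * (1 + 2 * χ / (1 + (χ : ℝ) ^ 2)) ^ 2 / 8 =
        (χ : ℝ) ^ 2 * (1 + (χ : ℝ)) ^ 4 / (2 * (1 + (χ : ℝ) ^ 2) ^ 4) := by field_simp; ring
    have e₂ : (2 * χ / (1 + (χ : ℝ) ^ 2)) ^ 2 * (1 + 2 * χ / (1 + (χ : ℝ) ^ 2)) / 8 =
        (χ : ℝ) ^ 2 * (1 + (χ : ℝ)) ^ 2 / (2 * (1 + (χ : ℝ) ^ 2) ^ 3) := by field_simp; ring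
    have e₃ : (2 * χ / (1 + (χ : ℝ) ^ 2)) ^ 3 / 8 = (χ : ℝ) ^ 3 / (1 + (χ : ℝ) ^ 2) ^ 3 := by
      field_simp; ring
    rw [e₁, e₂, e₃]
    simp [mul_assoc]
  · rw [div_lt_one (by positivity)]
    have h₂ : (χ : ℝ) * (1 + χ) ^ 2 ≤ (1 + (χ : ℝ) ^ 2) ^ 2 := by
      nlinarith [mul_nonneg (by linarith : (0 : ℝ) ≤ χ) (sq_nonneg ((χ : ℝ) - 1))]
    calc (χ : ℝ) ^ 2 * (1 + (χ : ℝ)) ^ 4 = ((χ : ℝ) * (1 + χ) ^ 2) ^ 2 := by ring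
      _ ≤ ((1 + (χ : ℝ) ^ 2) ^ 2) ^ 2 := by gcongr
      _ < 2 * (1 + (χ : ℝ) ^ 2) ^ 4 := by nlinarith [pow_pos h₁ 4]
  · rw [div_lt_div_iff₀ (by positivity) (by positivity), ← sub_pos]
    have : 0 < 4 * (χ : ℝ) ^ 3 * (1 + χ) ^ 2 * (1 + (χ : ℝ) ^ 2) ^ 3 := by positivity
    linear_combination this
  · rw [div_lt_div_iff₀ (by positivity) (by positivity), ← sub_pos]
    have : 0 < (χ : ℝ) ^ 2 * (1 + (χ : ℝ) ^ 2) ^ 3 * ((1 + χ) ^ 4 - 2 * χ * (1 + (χ : ℝ) ^ 2)) := by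
      have : 0 < (1 + (χ : ℝ)) ^ 4 - 2 * χ * (1 + (χ : ℝ) ^ 2) := by ring_nf; positivity
      positivity
    linear_combination this

end MERAbin
end
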